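/- Let d ≥ 2. For every constant C_0 > 0 there exist ε_0 ∈ (0,1) and C̃ > 0, depending only on d and C_0, with the following property. Let 0 < ε < ε_0, μ_ε = ε^{−(d−1)}, N ≥ 1, and let Φ_N : 𝔻^N → ℝ be a symmetric measurable function such that for some ρ_0, ρ_1, …, ρ_N > 0: (i) sup_{x_N ∈ 𝕋^d} ∫ |Φ_N(Z_N)| M^{⊗N}(V_N) dX_{N−1} dV_N ≤ C_0^N ρ_0, and (ii) for every ℓ = 1,…,N, sup_{x_{2N−ℓ} ∈ 𝕋^d} ∫ |Φ_N(Z_N) · Φ_N(Z_ℓ, Z_{N+1,2N−ℓ})| M^{⊗(2N−ℓ)}(V_{2N−ℓ}) dX_{2N−ℓ−1} dV_{2N−ℓ} ≤ C_0^N (μ_ε^{ℓ−1}/N^ℓ) ρ_ℓ, where Z_ℓ = (z_1,…,z_ℓ) and Z_{N+1,2N−ℓ} = (z_{N+1},…,z_{2N−ℓ}). Define E_ε(Φ_N) := (1/Z^ε) ∑_{p≥0} (μ_ε^p/p!) ∫ 1_{D^ε_{N+p}} M^{⊗(N+p)} Φ_N(Z_N) dZ_{N+p}, and for each n ≥ 0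 define Φ̂_N on 𝔻^n by Φ̂_N(Z_n) := μ_ε^{−N} ∑_{(i_1,…,i_N)} Φ_N(z_{i_1},…,z_{i_N}) − E_ε(Φ_N), the sum running over N-tuples of pairwise distinct indices in {1,…,n}. Then (1/Z^ε) ∑_{n≥0} (μ_ε^n/n!) ∫_{𝔻^n} 1_{D^ε_n}(Z_n) M^{⊗n}(V_n) · μ_ε · Φ̂_N(Z_n)² dZ_n ≤ C̃^N ( ∑_{ℓ=1}^N ρ_ℓ + ρ_0² ε ). -/

import Mathlib

open MeasureTheory Real
open scoped ENNReal BigOperators Classical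

noncomputable section

/-- The unit `d`-dimensional torus `𝕋^d = ℝ^d/ℤ^d`, as a product of unit circles.
It carries its Haar probability measure. -/
abbrev Torus (d : ℕ) := Fin d → AddCircle (1 : ℝ)

/-- The Euclidean quotient distance on the torus `𝕋^d`. -/
noncomputable def torusDist {d : ℕ} (x y : Torus d) : ℝ :=
  Real.sqrt (∑ i, dist (x i) (y i) ^ 2)

/-- The one-particle phase space `𝔻 = 𝕋^d × ℝ^d`. -/
abbrev Phase (d : ℕ) := Torus d × EuclideanSpace ℝ (Fin d)

/-- The standard Maxwellian `M(v) = (2π)^{−d/2} exp(−|v|²/2)`. -/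
noncomputable def maxwellian (d : ℕ) (v : EuclideanSpace ℝ (Fin d)) : ℝ :=
  (2 * π) ^ (-(d : ℝ) / 2) * Real.exp (-‖v‖ ^ 2 / 2)

/-- The Boltzmann-Grad density `μ_ε = ε^{−(d−1)}`. -/
noncomputable def mu (d : ℕ) (ε : ℝ) : ℝ := ε ^ (-((d : ℤ) - 1))

/-- The hard-core exclusion: `Z_N ∈ D^ε_N` iff all mutual torus distances of the
positions exceed `ε`. -/
def HardCore (d : ℕ) (ε : ℝ) {N : ℕ} (Z : Fin N → Phase d) : Prop :=
  ∀ i j, i ≠ j → ε < torusDist (Z i).1 (Z j).1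

/-- The density `1_{D^ε_N}(Z_N) M^{⊗N}(V_N)` of the hard-sphere Gibbs weight. -/
noncomputable def hsWeight (d : ℕ) (ε : ℝ) {N : ℕ} (Z : Fin N → Phase d) : ℝ :=
  (if HardCore d ε Z then 1 else 0) * ∏ i, maxwellian d (Z i).2

/-- The grand canonical partition function
`Z^ε = 1 + ∑_{N≥1} (μ_ε^N/N!) ∫ 1_{D^ε_N} M^{⊗N} dZ_N` (the `N = 0` term of the
series equals `1`). -/
noncomputable def partitionFn (d : ℕ) (ε : ℝ) : ℝ :=
  ∑' N : ℕ, mu d ε ^ N / N.factorial * ∫ Z : Fin N → Phase d, hsWeight d ε Z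

/-- The `N`-fold measure on `𝔻^N` in which the position of the last particle is frozen
at `x` (Dirac mass) while all other positions and all velocities carry their Haar /
Lebesgue measures; it realizes the integration `dX_{N−1} dV_N` at fixed `x_N = x`. -/
noncomputable def lastFixed (d N : ℕ) (x : Torus d) : Measure (Fin N → Phase d) :=
  Measure.pi fun i =>
    if (i : ℕ) = N - 1 then (Measure.dirac x).prod (volume : Measure (EuclideanSpace ℝ (Fin d)))
    else (volume : Measure (Phase d))

/-- The grand canonical expectation
`E_ε(Φ_N) = (1/Z^ε) ∑_{p≥0} (μ_ε^p/p!) ∫ 1_{D^ε_{N+p}} M^{⊗(N+p)} Φ_N(Z_N) dZ_{N+p}`. -/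
noncomputable def EexpPhi (d : ℕ) (ε : ℝ) {N : ℕ} (Φ : (Fin N → Phase d) → ℝ) : ℝ :=
  (partitionFn d ε)⁻¹ *
    ∑' p : ℕ, mu d ε ^ p / p.factorial *
      ∫ Z : Fin (N + p) → Phase d, hsWeight d ε Z * Φ (Z ∘ Fin.castAdd p)

/-- The centered variable `Φ̂_N` on the `n`-particle sector:
`Φ̂_N(Z_n) = μ_ε^{−N} ∑_{(i_1,…,i_N)} Φ_N(z_{i_1},…,z_{i_N}) − E_ε(Φ_N)`, the sum
running over `N`-tuples of pairwise distinct indices in `{1,…,n}` (i.e. over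
embeddings `Fin N ↪ Fin n`). -/
noncomputable def hatPhi (d : ℕ) (ε : ℝ) {N : ℕ} (Φ : (Fin N → Phase d) → ℝ)
    (n : ℕ) (Z : Fin n → Phase d) : ℝ :=
  (mu d ε ^ N)⁻¹ * ∑ f : Fin N ↪ Fin n, Φ (Z ∘ f) - EexpPhi d ε Φ

namespace HardCoreGas

section Basic

variable {E : Type*} [MeasurableSpace E]

/-- The law of a family of independent particles with one-particle law `ν`. -/
abbrev iid (ν : Measure E) (ι : Type) [Fintype ι] : Measure (ι → E) := Measure.pi fun _ => ν

lemma lintegral_iid_comp_equiv (ν : Measure E) [SigmaFinite ν] {ι κ : Type} [Fintype ι]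
    [Fintype κ] (e : ι ≃ κ) (f : (ι → E) → ℝ≥0∞) :
    ∫⁻ Z, f (Z ∘ e) ∂iid ν κ = ∫⁻ Y, f Y ∂iid ν ι := by
  have h := measurePreserving_piCongrLeft (fun _ : ι => ν) e.symm
  refine Eq.trans (lintegral_congr fun Z => congrArg f ?_) (h.lintegral_map_equiv f).symm
  ext i
  obtain ⟨k, rfl⟩ := e.symm.surjective i
  simp [MeasurableEquiv.coe_piCongrLeft, Equiv.piCongrLeft_apply_apply]

lemma lintegral_iid_sum (ν : Measure E) [SigmaFinite ν] {ι κ : Type} [Fintype ι]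
    [Fintype κ] {f : (ι ⊕ κ → E) → ℝ≥0∞} (hf : Measurable f) :
    ∫⁻ Z, f Z ∂iid ν (ι ⊕ κ) = ∫⁻ X, ∫⁻ Y, f (Sum.elim X Y) ∂iid ν κ ∂iid ν ι := by
  have h := (measurePreserving_sumPiEquivProdPi (fun _ : ι ⊕ κ => ν)).symm
  rw [h.lintegral_map_equiv f, lintegral_prod _ (by fun_prop)]
  rfl

lemma measurable_sumElim {ι κ : Type} :
    Measurable fun p : (ι → E) × (κ → E) => (Sum.elim p.1 p.2 : ι ⊕ κ → E) := by
  refine measurable_pi_lambda _ fun a => ?_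
  cases a <;> simp <;> fun_prop

/-- A symmetric measurable weight on configurations with arbitrary label types. -/
structure IsWeight (w : ∀ ι : Type, (ι → E) → ℝ≥0∞) : Prop where
  comp_equiv : ∀ {ι κ : Type} (e : ι ≃ κ) (Z : κ → E), w ι (Z ∘ e) = w κ Z
  measurable : ∀ (ι : Type) [Finite ι], Measurable (w ι)

/-- The grand canonical sum of a weight at activity `m`. -/
def grandSum (m : ℝ≥0∞) (ν : Measure E) (w : ∀ ι : Type, (ι → E) → ℝ≥0∞) : ℝ≥0∞ :=
  ∑' n : ℕ, m ^ n / (n.factorial : ℝ≥0∞) * ∫⁻ Y, w (Fin n) Y ∂iid ν (Fin n)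

/-- The weight `w` conditioned on the presence of the extra particles `X`. -/
def pinned (w : ∀ ι : Type, (ι → E) → ℝ≥0∞) {ι : Type} (X : ι → E) :
    ∀ κ : Type, (κ → E) → ℝ≥0∞ := fun _ Y => w _ (Sum.elim X Y)

lemma IsWeight.pinned {w : ∀ ι : Type, (ι → E) → ℝ≥0∞} (hw : IsWeight w) {ι : Type} [Finite ι]
    (X : ι → E) : IsWeight (pinned w X) where
  comp_equiv e Z := by
    rw [HardCoreGas.pinned, HardCoreGas.pinned, ← hw.comp_equiv (Equiv.sumCongr (Equiv.refl _) e)]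
    congr 1
    ext a
    cases a <;> rfl
  measurable κ _ := (hw.measurable _).comp
    (measurable_sumElim.comp (measurable_const.prodMk measurable_id))

lemma grandSum_mono {m : ℝ≥0∞} {ν : Measure E} {w w' : ∀ ι : Type, (ι → E) → ℝ≥0∞}
    (h : ∀ n Y, w (Fin n) Y ≤ w' (Fin n) Y) : grandSum m ν w ≤ grandSum m ν w' :=
  ENNReal.tsum_le_tsum fun n => mul_le_mul_right (lintegral_mono (h n)) _

lemma measurable_grandSum_pinned {m : ℝ≥0∞} {ν : Measure E} [SigmaFinite ν]
    {w : ∀ ι : Type, (ι → E) → ℝ≥0∞} (hw : IsWeight w) (ι : Type) [Finite ι] :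
    Measurable fun X : ι → E => grandSum m ν (pinned w X) := by
  refine Measurable.tsum fun n => Measurable.const_mul ?_ _
  exact Measurable.lintegral_prod_right ((hw.measurable _).comp measurable_sumElim)

lemma exists_sum_equiv_of_embedding {ι : Type} [Fintype ι] {p : ℕ}
    (f : ι ↪ Fin (p + Fintype.card ι)) :
    ∃ e : ι ⊕ Fin p ≃ Fin (p + Fintype.card ι), ∀ i, e (Sum.inl i) = f i := by
  have hc : Fintype.card (Fin p) =
      Fintype.card {x : Fin (p + Fintype.card ι) // ¬ x ∈ Set.range f} := by
    rw [Fintype.card_subtype_compl, Fintype.card_fin, Fintype.card_fin]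
    have : Fintype.card {x // x ∈ Set.range f} = Fintype.card ι :=
      (Fintype.card_congr (Equiv.ofInjective f f.injective)).symm
    omega
  refine ⟨(Equiv.sumCongr (Equiv.ofInjective f f.injective)
    (Fintype.equivOfCardEq hc)).trans (Equiv.sumCompl _), fun i => rfl⟩

/-- Campbell's formula for sums over tuples of distinct particles. -/
theorem campbell (m : ℝ≥0∞) (ν : Measure E) [SigmaFinite ν]
    {w : ∀ ι : Type, (ι → E) → ℝ≥0∞} (hw : IsWeight w) {ι : Type} [Fintype ι]
    {Ψ : (ι → E) → ℝ≥0∞} (hΨ : Measurable Ψ) :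
    ∑' n : ℕ, m ^ n / (n.factorial : ℝ≥0∞) *
        ∫⁻ Y, w (Fin n) Y * ∑ f : ι ↪ Fin n, Ψ (Y ∘ f) ∂iid ν (Fin n) =
      m ^ Fintype.card ι * ∫⁻ X, Ψ X * grandSum m ν (pinned w X) ∂iid ν ι := by
  have hpin : ∀ n, Measurable fun X : ι → E => ∫⁻ Y, pinned w X (Fin n) Y ∂iid ν (Fin n) :=
    fun n => Measurable.lintegral_prod_right ((hw.measurable _).comp measurable_sumElim)
  have hterm : ∀ (n : ℕ) (f : ι ↪ Fin n), Measurable fun Y : Fin n → E =>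
      w (Fin n) Y * Ψ (Y ∘ f) := fun n f =>
    (hw.measurable _).mul (hΨ.comp (by fun_prop))
  have key : ∀ p : ℕ, ∀ f : ι ↪ Fin (p + Fintype.card ι),
      ∫⁻ Y, w (Fin (p + Fintype.card ι)) Y * Ψ (Y ∘ f) ∂iid ν (Fin (p + Fintype.card ι)) =
        ∫⁻ X, Ψ X * ∫⁻ Y, pinned w X (Fin p) Y ∂iid ν (Fin p) ∂iid ν ι := by
    intro p f
    obtain ⟨e, he⟩ := exists_sum_equiv_of_embedding f
    have h1 : ∀ Y : Fin (p + Fintype.card ι) → E, w (Fin (p + Fintype.card ι)) Y * Ψ (Y ∘ f) =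
        (fun Z : ι ⊕ Fin p → E => w _ Z * Ψ (Z ∘ Sum.inl)) (Y ∘ e) := by
      intro Y
      simp only [hw.comp_equiv]
      congr 2
      ext i
      simp [he]
    simp_rw [h1]
    rw [lintegral_iid_comp_equiv ν e (fun Z : ι ⊕ Fin p → E => w _ Z * Ψ (Z ∘ Sum.inl)),
      lintegral_iid_sum]
    · refine lintegral_congr fun X => ?_
      rw [← lintegral_const_mul _ ((hw.pinned X).measurable _)]
      refine lintegral_congr fun Y => ?_
      rw [mul_comm]
      rfl
    · exact (hw.measurable _).mul (hΨ.comp (by fun_prop))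
  have hsum : ∀ n, ∫⁻ Y, w (Fin n) Y * ∑ f : ι ↪ Fin n, Ψ (Y ∘ f) ∂iid ν (Fin n) =
      ∑ f : ι ↪ Fin n, ∫⁻ Y, w (Fin n) Y * Ψ (Y ∘ f) ∂iid ν (Fin n) := by
    intro n
    simp_rw [Finset.mul_sum]
    exact lintegral_finsetSum _ fun f _ => hterm n f
  simp_rw [hsum]
  rw [← ENNReal.summable.sum_add_tsum_nat_add' (k := Fintype.card ι)]
  rw [Finset.sum_eq_zero, zero_add]
  · simp_rw [key, grandSum, ← ENNReal.tsum_mul_left]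
    rw [lintegral_tsum, ← ENNReal.tsum_mul_left]
    · refine tsum_congr fun p => ?_
      have hcard : (Finset.univ : Finset (ι ↪ Fin (p + Fintype.card ι))).card =
          (p + Fintype.card ι).descFactorial (Fintype.card ι) := by
        rw [Finset.card_univ, Fintype.card_embedding_eq, Fintype.card_fin]
      rw [Finset.sum_const, hcard, nsmul_eq_mul]
      have hfac := Nat.factorial_mul_descFactorial
        (Nat.le_add_left (Fintype.card ι) p)
      rw [Nat.add_sub_cancel] at hfac
      set k := Fintype.card ι
      have hq : ∀ X : ι → E, Ψ X * (m ^ p / (p.factorial : ℝ≥0∞) *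
          ∫⁻ Y, pinned w X (Fin p) Y ∂iid ν (Fin p)) = (m ^ p / (p.factorial : ℝ≥0∞)) *
          (Ψ X * ∫⁻ Y, pinned w X (Fin p) Y ∂iid ν (Fin p)) := fun X => by ring
      simp_rw [hq]
      rw [lintegral_const_mul _ (show Measurable fun X => Ψ X * _ from hΨ.mul (hpin p)),
        ← mul_assoc, ← mul_assoc]
      congr 1
      have h0 : ((p.factorial : ℕ) : ℝ≥0∞) ≠ 0 := by exact_mod_cast p.factorial_ne_zero
      have h1 : (((p + k).descFactorial k : ℕ) : ℝ≥0∞) ≠ 0 := by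
        intro h
        have : (p + k).descFactorial k = 0 := by exact_mod_cast h
        rw [this, mul_zero] at hfac
        exact (p + k).factorial_ne_zero hfac.symm
      rw [← hfac, Nat.cast_mul, pow_add, div_eq_mul_inv, div_eq_mul_inv,
        ENNReal.mul_inv (Or.inl h0) (Or.inl (ENNReal.natCast_ne_top _))]
      calc _ = m ^ p * m ^ k * (p.factorial : ℝ≥0∞)⁻¹ *
            ((((p + k).descFactorial k : ℕ) : ℝ≥0∞)⁻¹ *
              (((p + k).descFactorial k : ℕ) : ℝ≥0∞)) := by ring
        _ = _ := by
          rw [ENNReal.inv_mul_cancel h1 (ENNReal.natCast_ne_top _)]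
          ring
    · intro p
      exact (hΨ.mul ((hpin p).const_mul _)).aemeasurable
  · intro n hn
    have : IsEmpty (ι ↪ Fin n) := by
      refine Function.Embedding.isEmpty_of_card_lt ?_
      simpa using hn
    simp

/-- The product of two grand canonical sums is a grand canonical sum over two-colourings. -/
theorem grandSum_mul (m : ℝ≥0∞) (ν : Measure E) [SigmaFinite ν]
    {a b : ∀ ι : Type, (ι → E) → ℝ≥0∞} (ha : IsWeight a) (hb : IsWeight b) :
    grandSum m ν a * grandSum m ν b = ∑' n : ℕ, m ^ n / (n.factorial : ℝ≥0∞) *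
      ∫⁻ Y : Fin n → E, ∑ s : Finset (Fin n), a {i // i ∈ s} (fun i => Y i) *
        b {i // i ∉ s} (fun i => Y i) ∂iid ν (Fin n) := by
  set A : ℕ → ℝ≥0∞ := fun n => ∫⁻ Y, a (Fin n) Y ∂iid ν (Fin n)
  set B : ℕ → ℝ≥0∞ := fun n => ∫⁻ Y, b (Fin n) Y ∂iid ν (Fin n)
  have hcard : ∀ {w : ∀ ι : Type, (ι → E) → ℝ≥0∞}, IsWeight w → ∀ (κ : Type) [Fintype κ] (k : ℕ),
      Fintype.card κ = k → ∫⁻ Y, w κ Y ∂iid ν κ = ∫⁻ Y, w (Fin k) Y ∂iid ν (Fin k) := by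
    intro w hw κ _ k hk
    have e : κ ≃ Fin k := Fintype.equivFinOfCardEq hk
    rw [← lintegral_iid_comp_equiv ν e]
    simp_rw [hw.comp_equiv]
  have hs : ∀ (n : ℕ) (s : Finset (Fin n)),
      ∫⁻ Y : Fin n → E, a {i // i ∈ s} (fun i => Y i) * b {i // i ∉ s} (fun i => Y i)
        ∂iid ν (Fin n) = A s.card * B (n - s.card) := by
    intro n s
    have h := measurePreserving_piEquivPiSubtypeProd (fun _ : Fin n => ν) (fun i => i ∈ s)
    have h2 := h.lintegral_map_equiv (fun q => a {i // i ∈ s} q.1 * b {i // i ∉ s} q.2)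
    have h3 : ∫⁻ Y : Fin n → E, a {i // i ∈ s} (fun i => Y i) * b {i // i ∉ s} (fun i => Y i)
        ∂iid ν (Fin n) = ∫⁻ q, a {i // i ∈ s} q.1 * b {i // i ∉ s} q.2
          ∂((iid ν {i // i ∈ s}).prod (iid ν {i // i ∉ s})) := by
      convert h2.symm using 4 <;> rfl
    rw [h3, lintegral_prod_mul (ha.measurable _).aemeasurable (hb.measurable _).aemeasurable,
      hcard ha _ s.card (by simp), hcard hb _ (n - s.card) (by simp [Fintype.card_subtype_compl])]
  have hL : grandSum m ν a * grandSum m ν b = ∑' n : ℕ, ∑ pq ∈ Finset.HasAntidiagonal.antidiagonal n,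
      (m ^ pq.1 / (pq.1.factorial : ℝ≥0∞) * A pq.1) *
        (m ^ pq.2 / (pq.2.factorial : ℝ≥0∞) * B pq.2) := by
    rw [grandSum, grandSum, ← ENNReal.tsum_mul_right]
    simp_rw [← ENNReal.tsum_mul_left]
    rw [← ENNReal.tsum_prod (f := fun p q => (m ^ p / (p.factorial : ℝ≥0∞) * A p) *
        (m ^ q / (q.factorial : ℝ≥0∞) * B q)),
      ← Finset.HasAntidiagonal.sigmaAntidiagonalEquivProd.tsum_eq, ENNReal.tsum_sigma']
    refine tsum_congr fun n => ?_
    rw [tsum_fintype]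
    exact Finset.sum_coe_sort (Finset.HasAntidiagonal.antidiagonal n) fun pq : ℕ × ℕ =>
      (m ^ pq.1 / (pq.1.factorial : ℝ≥0∞) * A pq.1) *
        (m ^ pq.2 / (pq.2.factorial : ℝ≥0∞) * B pq.2)
  rw [hL]
  refine tsum_congr fun n => ?_
  rw [lintegral_finsetSum]
  · simp_rw [hs]
    have h := Finset.sum_powerset_apply_card (fun k => A k * B (n - k))
      (x := (Finset.univ : Finset (Fin n)))
    rw [Finset.powerset_univ, Finset.card_univ, Fintype.card_fin] at h
    rw [h, Finset.Nat.sum_antidiagonal_eq_sum_range_succ_mk, Finset.mul_sum]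
    refine Finset.sum_congr rfl fun k hk => ?_
    have hk' : k ≤ n := by simpa [Nat.lt_succ_iff] using hk
    have hc := Nat.choose_mul_factorial_mul_factorial hk'
    have hm : m ^ n = m ^ k * m ^ (n - k) := by rw [← pow_add, Nat.add_sub_cancel' hk']
    simp only [nsmul_eq_mul, hm]
    have h0 : ∀ j : ℕ, ((j.factorial : ℕ) : ℝ≥0∞) ≠ 0 := fun j => by
      exact_mod_cast j.factorial_ne_zero
    have hch : ((n.choose k : ℕ) : ℝ≥0∞) ≠ 0 := by exact_mod_cast (Nat.choose_pos hk').ne'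
    have ht : ∀ j : ℕ, (j : ℝ≥0∞) ≠ ⊤ := ENNReal.natCast_ne_top
    rw [← hc, Nat.cast_mul, Nat.cast_mul]
    simp only [div_eq_mul_inv]
    rw [ENNReal.mul_inv (Or.inr (ht _)) (Or.inr (h0 _)), ENNReal.mul_inv (Or.inl hch)
      (Or.inl (ht _))]
    calc _ = m ^ k * m ^ (n - k) * (k.factorial : ℝ≥0∞)⁻¹ * ((n - k).factorial : ℝ≥0∞)⁻¹ *
          (A k * B (n - k)) := by ring
      _ = m ^ k * m ^ (n - k) * (k.factorial : ℝ≥0∞)⁻¹ * ((n - k).factorial : ℝ≥0∞)⁻¹ *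
          (A k * B (n - k)) * (((n.choose k : ℕ) : ℝ≥0∞)⁻¹ * ((n.choose k : ℕ) : ℝ≥0∞)) := by
        rw [ENNReal.inv_mul_cancel hch (ht _), mul_one]
      _ = _ := by ring
  · intro s _
    exact ((ha.measurable _).comp (by fun_prop)).mul ((hb.measurable _).comp (by fun_prop))

end Basic

section Swapping

variable {E : Type*}

/-- No two distinct particles of `Y` are related by `R`. -/
def Indep (R : E → E → Prop) {ι : Type} (Y : ι → E) : Prop := ∀ i j, i ≠ j → ¬ R (Y i) (Y j)

/-- The hard-core indicator as a weight. -/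
def hardCoreWeight (R : E → E → Prop) (ι : Type) (Y : ι → E) : ℝ≥0∞ :=
  if Indep R Y then 1 else 0

/-- Overlapping particles carry different colours. -/
def ProperColouring (R : E → E → Prop) {ι : Type} (Y : ι → E) (s : Finset ι) : Prop :=
  ∀ i j, i ≠ j → R (Y i) (Y j) → (i ∈ s ↔ j ∉ s)

/-- The number of proper two-colourings. -/
def colourWeight (R : E → E → Prop) (ι : Type) (Y : ι → E) : ℝ≥0∞ :=
  ∑' s : Finset ι, if ProperColouring R Y s then 1 else 0

/-- `Chain R x l y` says that consecutive entries of `x :: l ++ [y]` are related by `R`. -/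
def Chain (R : E → E → Prop) : E → List E → E → Prop
  | x, [], y => R x y
  | x, z :: l, y => R x z ∧ Chain R z l y

lemma Chain.concat {R : E → E → Prop} {l : List E} {x y z : E} (h : Chain R x l y) (hz : R y z) :
    Chain R x (l ++ [y]) z := by
  induction l generalizing x with
  | nil => exact ⟨h, hz⟩
  | cons a l ih => exact ⟨h.1, ih h.2⟩

lemma Chain.suffix {R : E → E → Prop} {p q : List E} {x y z : E}
    (h : Chain R x (p ++ y :: q) z) : Chain R y q z := by
  induction p generalizing x with
  | nil => exact h.2
  | cons a l ih => exact ih h.2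

lemma Chain.exists_nodup {R : E → E → Prop} {κ : Type} (Y : κ → E) {x y : E} (l : List κ)
    (h : Chain R x (l.map Y) y) : ∃ l' : List κ, l'.Nodup ∧ Chain R x (l'.map Y) y := by
  induction l generalizing x with
  | nil => exact ⟨[], List.nodup_nil, h⟩
  | cons v t ih =>
    obtain ⟨t', ht', hc⟩ := ih h.2
    by_cases hv : v ∈ t'
    · obtain ⟨p, q, rfl⟩ := List.append_of_mem hv
      refine ⟨v :: q, (List.nodup_append.1 ht').2.1, h.1, ?_⟩
      rw [List.map_append, List.map_cons] at hc
      exact hc.suffix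
    · exact ⟨v :: t', List.nodup_cons.2 ⟨hv, ht'⟩, h.1, hc⟩

/-- The number of chains of distinct particles of `Y` joining a particle of `X` to one of `X'`. -/
def chainCount (R : E → E → Prop) {ι ι' κ : Type} [Fintype ι] [Fintype ι'] [Fintype κ]
    (X : ι → E) (X' : ι' → E) (Y : κ → E) : ℝ≥0∞ :=
  ∑ i, ∑ j, ∑' k : ℕ, ∑ f : Fin k ↪ κ,
    if Chain R (X i) (List.ofFn (Y ∘ f)) (X' j) then 1 else 0

lemma one_le_chainCount {R : E → E → Prop} {ι ι' κ : Type} [Fintype ι] [Fintype ι'] [Fintype κ]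
    {X : ι → E} {X' : ι' → E} {Y : κ → E} {i : ι} {j : ι'} (l : List κ)
    (h : Chain R (X i) (l.map Y) (X' j)) : 1 ≤ chainCount R X X' Y := by
  obtain ⟨l, hl, h⟩ := h.exists_nodup
  let f : Fin l.length ↪ κ := ⟨l.get, List.nodup_iff_injective_get.1 hl⟩
  have hf : List.ofFn (Y ∘ f) = l.map Y := by
    rw [← List.map_ofFn]
    exact congrArg _ (List.ofFn_get l)
  calc (1 : ℝ≥0∞) = if Chain R (X i) (List.ofFn (Y ∘ f)) (X' j) then 1 else 0 := by
        rw [hf, if_pos h]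
    _ ≤ ∑ f : Fin l.length ↪ κ, if Chain R (X i) (List.ofFn (Y ∘ f)) (X' j) then 1 else 0 :=
        Finset.single_le_sum
          (f := fun f : Fin l.length ↪ κ =>
            if Chain R (X i) (List.ofFn (Y ∘ f)) (X' j) then (1 : ℝ≥0∞) else 0)
          (fun _ _ => zero_le) (Finset.mem_univ f)
    _ ≤ ∑' k : ℕ, ∑ f : Fin k ↪ κ, if Chain R (X i) (List.ofFn (Y ∘ f)) (X' j) then 1 else 0 :=
        ENNReal.le_tsum (f := fun k : ℕ => ∑ f : Fin k ↪ κ,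
          if Chain R (X i) (List.ofFn (Y ∘ f)) (X' j) then (1 : ℝ≥0∞) else 0) l.length
    _ ≤ ∑ j, ∑' k : ℕ, ∑ f : Fin k ↪ κ,
          if Chain R (X i) (List.ofFn (Y ∘ f)) (X' j) then 1 else 0 :=
        Finset.single_le_sum (f := fun j => ∑' k : ℕ, ∑ f : Fin k ↪ κ,
          if Chain R (X i) (List.ofFn (Y ∘ f)) (X' j) then (1 : ℝ≥0∞) else 0)
          (fun _ _ => zero_le) (Finset.mem_univ j)
    _ ≤ _ := Finset.single_le_sum (f := fun i => ∑ j, ∑' k : ℕ, ∑ f : Fin k ↪ κ,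
          if Chain R (X i) (List.ofFn (Y ∘ f)) (X' j) then (1 : ℝ≥0∞) else 0)
          (fun _ _ => zero_le) (Finset.mem_univ i)

/-- Colourings in which one class avoids both boundary families. -/
def JointColouring (R : E → E → Prop) {ι ι' κ : Type} (X : ι → E) (X' : ι' → E) (Y : κ → E)
    (s : Finset κ) : Prop :=
  Indep R (fun i : {i // i ∈ s} => Y i) ∧
    Indep R (Sum.elim (Sum.elim X X') fun i : {i // i ∉ s} => Y i)

/-- Colourings in which each class avoids its own boundary family. -/
def SplitColouring (R : E → E → Prop) {ι ι' κ : Type} (X : ι → E) (X' : ι' → E) (Y : κ → E)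
    (s : Finset κ) : Prop :=
  Indep R (Sum.elim X fun i : {i // i ∈ s} => Y i) ∧
    Indep R (Sum.elim X' fun i : {i // i ∉ s} => Y i)

lemma properColouring_iff {R : E → E → Prop} {κ : Type} {Y : κ → E} {s : Finset κ} :
    ProperColouring R Y s ↔ Indep R (fun i : {i // i ∈ s} => Y i) ∧
      Indep R (fun i : {i // i ∉ s} => Y i) := by
  constructor
  · intro h
    refine ⟨fun i j hij hR => ?_, fun i j hij hR => ?_⟩
    · exact (h i j (fun e => hij (Subtype.ext e)) hR).1 i.2 j.2
    · exact i.2 ((h i j (fun e => hij (Subtype.ext e)) hR).2 j.2)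
  · rintro ⟨h1, h2⟩ i j hij hR
    constructor
    · intro hi hj
      exact h1 ⟨i, hi⟩ ⟨j, hj⟩ (by simpa using hij) hR
    · intro hj
      by_contra hi
      exact h2 ⟨i, hi⟩ ⟨j, hj⟩ (by simpa using hij) hR

lemma indep_sumElim {R : E → E → Prop} (hR : ∀ x y, R x y → R y x) {ι κ : Type} {X : ι → E}
    {Y : κ → E} : Indep R (Sum.elim X Y) ↔ Indep R X ∧ Indep R Y ∧ ∀ i v, ¬ R (X i) (Y v) := by
  constructor
  · intro h
    exact ⟨fun i j hij => h (Sum.inl i) (Sum.inl j) (by simpa using hij),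
      fun i j hij => h (Sum.inr i) (Sum.inr j) (by simpa using hij),
      fun i v => h (Sum.inl i) (Sum.inr v) (by simp)⟩
  · rintro ⟨h1, h2, h3⟩ (i | i) (j | j) hij
    · exact h1 i j (by simpa using hij)
    · exact h3 i j
    · exact fun h => h3 j i (hR _ _ h)
    · exact h2 i j (by simpa using hij)

lemma jointColouring_iff_splitColouring {R : E → E → Prop} (hR : ∀ x y, R x y → R y x)
    {ι ι' κ : Type} {X : ι → E} {X' : ι' → E} {Y : κ → E} {T s : Finset κ}
    (hX : ∀ i j, ¬ R (X i) (X' j)) (hT1 : ∀ i v, R (X i) (Y v) → v ∈ T)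
    (hT2 : ∀ v w, R (Y v) (Y w) → v ∈ T → w ∈ T) (hT3 : ∀ v ∈ T, ∀ j, ¬ R (Y v) (X' j)) :
    JointColouring R X X' Y s ↔ SplitColouring R X X' Y (symmDiff T s) := by
  have hP : ProperColouring R Y s ↔ ProperColouring R Y (symmDiff T s) := by
    refine forall₄_congr fun i j _ => ?_
    intro h
    have h1 := hT2 _ _ h
    have h2 := hT2 _ _ (hR _ _ h)
    simp only [Finset.mem_symmDiff]
    tauto
  simp only [JointColouring, SplitColouring, indep_sumElim hR]
  rw [properColouring_iff, properColouring_iff] at hP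
  have e1 : (∀ (i : ι ⊕ ι') (v : {v // v ∉ s}), ¬ R (Sum.elim X X' i) (Y v)) ↔
      (∀ i v, R (X i) (Y v) → v ∈ s) ∧ ∀ j v, R (X' j) (Y v) → v ∈ s := by
    constructor
    · intro h
      refine ⟨fun i v hv => ?_, fun i v hv => ?_⟩
      · by_contra hs
        exact h (Sum.inl i) ⟨v, hs⟩ hv
      · by_contra hs
        exact h (Sum.inr i) ⟨v, hs⟩ hv
    · rintro ⟨h1, h2⟩ (i | i) ⟨v, hv⟩ h
      · exact hv (h1 _ _ h)
      · exact hv (h2 _ _ h)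
  have e2 : (∀ (i : ι) (v : {v // v ∈ symmDiff T s}), ¬ R (X i) (Y v)) ↔
      ∀ i v, R (X i) (Y v) → v ∈ s := by
    constructor
    · intro h i v hv
      by_contra hs
      exact h i ⟨v, Finset.mem_symmDiff.2 (Or.inl ⟨hT1 _ _ hv, hs⟩)⟩ hv
    · rintro h i ⟨v, hv⟩ hv'
      rw [Finset.mem_symmDiff] at hv
      have := h _ _ hv'
      have := hT1 _ _ hv'
      tauto
  have e3 : (∀ (i : ι') (v : {v // v ∉ symmDiff T s}), ¬ R (X' i) (Y v)) ↔
      ∀ j v, R (X' j) (Y v) → v ∈ s := by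
    have hT3' : ∀ j v, R (X' j) (Y v) → v ∉ T := fun j v h hv => hT3 v hv j (hR _ _ h)
    constructor
    · intro h i v hv
      by_contra hs
      refine h i ⟨v, fun hm => ?_⟩ hv
      rw [Finset.mem_symmDiff] at hm
      have := hT3' _ _ hv
      tauto
    · rintro h i ⟨v, hv⟩ hv'
      rw [Finset.mem_symmDiff] at hv
      have := h _ _ hv'
      have := hT3' _ _ hv'
      tauto
  rw [e1, e2, e3]
  tauto

lemma sum_jointColouring_eq_or_one_le_chainCount {R : E → E → Prop} (hR : ∀ x y, R x y → R y x)
    {ι ι' κ : Type} [Fintype ι] [Fintype ι'] [Fintype κ] (X : ι → E) (X' : ι' → E) (Y : κ → E) :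
    (∑ s : Finset κ, if JointColouring R X X' Y s then (1 : ℝ≥0∞) else 0) =
        ∑ s : Finset κ, (if SplitColouring R X X' Y s then (1 : ℝ≥0∞) else 0) ∨
      1 ≤ chainCount R X X' Y := by
  by_cases hbad : ∃ i j, ∃ l : List κ, Chain R (X i) (l.map Y) (X' j)
  · obtain ⟨i, j, l, hl⟩ := hbad
    exact Or.inr (one_le_chainCount l hl)
  · left
    push Not at hbad
    set T : Finset κ := {v | ∃ i, ∃ l : List κ, Chain R (X i) (l.map Y) (Y v)} with hT
    have hmem : ∀ v, v ∈ T ↔ ∃ i, ∃ l : List κ, Chain R (X i) (l.map Y) (Y v) := by simp [hT]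
    refine Fintype.sum_equiv (symmDiff_right_involutive T).toPerm _ _ fun s => ?_
    have := jointColouring_iff_splitColouring hR (X := X) (X' := X') (Y := Y) (T := T) (s := s)
      (fun i j h => hbad i j [] h) (fun i v h => (hmem v).2 ⟨i, [], h⟩) ?_ ?_
    · exact if_congr this rfl rfl
    · intro v w hvw hv
      obtain ⟨i, l, hl⟩ := (hmem v).1 hv
      refine (hmem w).2 ⟨i, l ++ [v], ?_⟩
      rw [List.map_append]
      exact hl.concat hvw
    · intro v hv j hj
      obtain ⟨i, l, hl⟩ := (hmem v).1 hv
      refine hbad i j (l ++ [v]) ?_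
      rw [List.map_append]
      exact hl.concat hj

lemma sum_jointColouring_le {R : E → E → Prop} (hR : ∀ x y, R x y → R y x)
    {ι ι' κ : Type} [Fintype ι] [Fintype ι'] [Fintype κ] (X : ι → E) (X' : ι' → E) (Y : κ → E) :
    (∑ s : Finset κ, if JointColouring R X X' Y s then (1 : ℝ≥0∞) else 0) ≤
      (∑ s : Finset κ, if SplitColouring R X X' Y s then (1 : ℝ≥0∞) else 0) +
        colourWeight R κ Y * chainCount R X X' Y := by
  rcases sum_jointColouring_eq_or_one_le_chainCount hR X X' Y with h | h
  · exact h.le.trans le_self_add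
  · refine le_trans ?_ (le_add_left (le_mul_of_one_le_right zero_le h))
    rw [colourWeight, tsum_fintype]
    refine Finset.sum_le_sum fun s _ => ?_
    by_cases hs : JointColouring R X X' Y s
    · rw [if_pos hs, if_pos (properColouring_iff.2 ⟨hs.1, ((indep_sumElim hR).1 hs.2).2.1⟩)]
    · simp [hs]

lemma sum_splitColouring_le {R : E → E → Prop} (hR : ∀ x y, R x y → R y x)
    {ι ι' κ : Type} [Fintype ι] [Fintype ι'] [Fintype κ] (X : ι → E) (X' : ι' → E) (Y : κ → E) :
    (∑ s : Finset κ, if SplitColouring R X X' Y s then (1 : ℝ≥0∞) else 0) ≤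
      (∑ s : Finset κ, if JointColouring R X X' Y s then (1 : ℝ≥0∞) else 0) +
        colourWeight R κ Y * chainCount R X X' Y := by
  rcases sum_jointColouring_eq_or_one_le_chainCount hR X X' Y with h | h
  · exact h.ge.trans le_self_add
  · refine le_trans ?_ (le_add_left (le_mul_of_one_le_right zero_le h))
    rw [colourWeight, tsum_fintype]
    refine Finset.sum_le_sum fun s _ => ?_
    by_cases hs : SplitColouring R X X' Y s
    · rw [if_pos hs, if_pos (properColouring_iff.2
        ⟨((indep_sumElim hR).1 hs.1).2.1, ((indep_sumElim hR).1 hs.2).2.1⟩)]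
    · simp [hs]

lemma colourWeight_sumElim_le (R : E → E → Prop) {ι κ : Type} [Fintype ι] [Fintype κ] (X : ι → E)
    (Y : κ → E) :
    colourWeight R (ι ⊕ κ) (Sum.elim X Y) ≤ 2 ^ Fintype.card ι * colourWeight R κ Y := by
  simp only [colourWeight, tsum_fintype]
  calc ∑ s : Finset (ι ⊕ κ), (if ProperColouring R (Sum.elim X Y) s then (1 : ℝ≥0∞) else 0)
      ≤ ∑ p : Finset ι × Finset κ, if ProperColouring R Y p.2 then (1 : ℝ≥0∞) else 0 := by
        rw [← (Finset.sumEquiv (α := ι) (β := κ)).toEquiv.sum_comp]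
        refine Finset.sum_le_sum fun s _ => ?_
        by_cases hs : ProperColouring R (Sum.elim X Y) s
        · rw [if_pos hs, if_pos]
          intro i j hij h
          simpa using hs (Sum.inr i) (Sum.inr j) (by simpa using hij) h
        · simp [hs]
    _ = _ := by
        rw [Fintype.sum_prod_type]
        simp

end Swapping

section Decorrelation

variable {E : Type*} [MeasurableSpace E]

lemma measurable_ite_one {α : Type*} [MeasurableSpace α] {p : α → Prop}
    (hp : MeasurableSet {a | p a}) : Measurable fun a => if p a then (1 : ℝ≥0∞) else 0 :=
  Measurable.ite hp measurable_const measurable_const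

lemma ite_one_mul_ite_one (p q : Prop) :
    (if p then (1 : ℝ≥0∞) else 0) * (if q then 1 else 0) = if p ∧ q then 1 else 0 := by
  by_cases p <;> by_cases q <;> simp [*]

lemma measurableSet_indep {R : E → E → Prop} (hRm : MeasurableSet {p : E × E | R p.1 p.2})
    (ι : Type) [Finite ι] : MeasurableSet {Y : ι → E | Indep R Y} := by
  simp only [Indep, Set.ofPred_forall]
  refine MeasurableSet.iInter fun i => MeasurableSet.iInter fun j => MeasurableSet.iInter fun _ => ?_
  exact (hRm.preimage (f := fun Y : ι → E => (Y i, Y j)) (by fun_prop)).compl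

lemma isWeight_hardCoreWeight {R : E → E → Prop} (hRm : MeasurableSet {p : E × E | R p.1 p.2}) :
    IsWeight (hardCoreWeight R) where
  comp_equiv e Z := by
    have : Indep R (Z ∘ e) ↔ Indep R Z := by
      refine ⟨fun h i j hij => ?_, fun h i j hij => h _ _ (e.injective.ne hij)⟩
      simpa using h (e.symm i) (e.symm j) (e.symm.injective.ne hij)
    simp only [hardCoreWeight, this]
  measurable ι _ := measurable_ite_one (measurableSet_indep hRm ι)

lemma isWeight_colourWeight {R : E → E → Prop} (hRm : MeasurableSet {p : E × E | R p.1 p.2}) :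
    IsWeight (colourWeight R) where
  comp_equiv {ι κ} e Z := by
    simp only [colourWeight]
    rw [← Equiv.tsum_eq e.finsetCongr fun s => if ProperColouring R Z s then (1 : ℝ≥0∞) else 0]
    refine tsum_congr fun s => if_congr ?_ rfl rfl
    constructor
    · intro h i j hij hR
      simpa using h (e.symm i) (e.symm j) (e.symm.injective.ne hij) (by simpa using hR)
    · intro h i j hij hR
      simpa using h (e i) (e j) (e.injective.ne hij) hR
  measurable ι _ := by
    refine Measurable.tsum fun s => measurable_ite_one ?_
    simp only [ProperColouring, Set.ofPred_forall]
    refine MeasurableSet.iInter fun i => MeasurableSet.iInter fun j =>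
      MeasurableSet.iInter fun _ => ?_
    by_cases h : i ∈ s ↔ j ∉ s
    · simp [h]
    · simp only [h, imp_false]
      exact (hRm.preimage (f := fun Y : ι → E => (Y i, Y j)) (by fun_prop)).compl

lemma measurableSet_chain {R : E → E → Prop} (hRm : MeasurableSet {p : E × E | R p.1 p.2})
    (k : ℕ) : MeasurableSet
      {p : E × (Fin k → E) × E | Chain R p.1 (List.ofFn p.2.1) p.2.2} := by
  induction k with
  | zero =>
    simp only [List.ofFn_zero, Chain]
    exact hRm.preimage (f := fun p : E × (Fin 0 → E) × E => (p.1, p.2.2)) (by fun_prop)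
  | succ k ih =>
    simp only [List.ofFn_succ, Chain]
    have h1 := hRm.preimage (f := fun p : E × (Fin (k + 1) → E) × E => (p.1, p.2.1 0))
      (by fun_prop)
    have h2 := ih.preimage (f := fun p : E × (Fin (k + 1) → E) × E =>
      (p.2.1 0, (fun i : Fin k => p.2.1 i.succ), p.2.2)) (by fun_prop)
    exact h1.inter h2

/-- The measure of the set of chains of length `k` joining `x` to `y`. -/
def chainKernel (R : E → E → Prop) (ν : Measure E) (k : ℕ) (x y : E) : ℝ≥0∞ :=
  ∫⁻ z : Fin k → E, (if Chain R x (List.ofFn z) y then 1 else 0) ∂iid ν (Fin k)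

lemma measurable_chainKernel {R : E → E → Prop} (hRm : MeasurableSet {p : E × E | R p.1 p.2})
    (ν : Measure E) [SigmaFinite ν] (k : ℕ) :
    Measurable fun p : E × E => chainKernel R ν k p.1 p.2 := by
  refine Measurable.lintegral_prod_right (f := fun (p : E × E) (z : Fin k → E) =>
    if Chain R p.1 (List.ofFn z) p.2 then (1 : ℝ≥0∞) else 0) ?_
  exact measurable_ite_one ((measurableSet_chain hRm k).preimage
    (f := fun q : (E × E) × (Fin k → E) => (q.1.1, q.2, q.1.2)) (by fun_prop))

lemma chainKernel_zero (R : E → E → Prop) (ν : Measure E) (x y : E) :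
    chainKernel R ν 0 x y = if R x y then 1 else 0 := by
  simp only [chainKernel, List.ofFn_zero, Chain]
  rw [iid, Measure.pi_of_empty _ (fun i => i.elim0), lintegral_dirac]

lemma chainKernel_succ {R : E → E → Prop} (hRm : MeasurableSet {p : E × E | R p.1 p.2})
    (ν : Measure E) [SigmaFinite ν] (k : ℕ) (x y : E) :
    chainKernel R ν (k + 1) x y = ∫⁻ z, (if R x z then 1 else 0) * chainKernel R ν k z y ∂ν := by
  have h := (measurePreserving_piFinSuccAbove (fun _ : Fin (k + 1) => ν) 0).symm
  rw [chainKernel, iid, h.lintegral_map_equiv, lintegral_prod]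
  · refine lintegral_congr fun z => ?_
    rw [chainKernel, ← lintegral_const_mul]
    · refine lintegral_congr fun t => ?_
      have : List.ofFn ((MeasurableEquiv.piFinSuccAbove (fun _ : Fin (k + 1) => E) 0).symm (z, t)) =
          z :: List.ofFn t := by
        rw [List.ofFn_succ]
        rfl
      simp only [this, Chain]
      by_cases h1 : R x z <;> simp [h1]
    · exact measurable_ite_one ((measurableSet_chain hRm k).preimage
        (f := fun t : Fin k → E => (z, t, y)) (by fun_prop))
  · refine ((measurable_ite_one ((measurableSet_chain hRm (k + 1)).preimage
      (f := fun t : Fin (k + 1) → E => (x, t, y)) (by fun_prop))).comp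
        (MeasurableEquiv.measurable _)).aemeasurable

lemma lintegral_mul_chainKernel_le {R : E → E → Prop}
    (hRm : MeasurableSet {p : E × E | R p.1 p.2}) (ν : Measure E) [SigmaFinite ν]
    {κ b : ℝ≥0∞} (hκ : ∀ x, ν {y | R x y} ≤ κ) {ι : Type} [Fintype ι] {f : (ι → E) → ℝ≥0∞}
    (hf : Measurable f) (j : ι)
    (hb : ∀ x, ∫⁻ X, f X * (if R x (X j) then 1 else 0) ∂iid ν ι ≤ b) (k : ℕ) (x : E) :
    ∫⁻ X, f X * chainKernel R ν k x (X j) ∂iid ν ι ≤ κ ^ k * b := by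
  have hKm := measurable_chainKernel hRm ν
  have hx : ∀ x, Measurable fun z => if R x z then (1 : ℝ≥0∞) else 0 := fun x =>
    measurable_ite_one (hRm.preimage (f := fun z => (x, z)) (by fun_prop))
  induction k generalizing x with
  | zero => simpa [chainKernel_zero] using hb x
  | succ k ih =>
    calc ∫⁻ X, f X * chainKernel R ν (k + 1) x (X j) ∂iid ν ι
        = ∫⁻ X, ∫⁻ z, f X * ((if R x z then 1 else 0) * chainKernel R ν k z (X j)) ∂ν
            ∂iid ν ι := by
          refine lintegral_congr fun X => ?_
          rw [chainKernel_succ hRm, lintegral_const_mul]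
          exact (hx x).mul ((hKm k).comp (by fun_prop : Measurable fun z => (z, X j)))
      _ = ∫⁻ z, ∫⁻ X, f X * ((if R x z then 1 else 0) * chainKernel R ν k z (X j)) ∂iid ν ι
            ∂ν := by
          refine lintegral_lintegral_swap (Measurable.aemeasurable ?_)
          exact (hf.comp measurable_fst).mul (((hx x).comp measurable_snd).mul
            ((hKm k).comp (by fun_prop : Measurable fun q : (ι → E) × E => (q.2, q.1 j))))
      _ ≤ ∫⁻ z, (if R x z then 1 else 0) * (κ ^ k * b) ∂ν := by
          refine lintegral_mono fun z => ?_
          by_cases h : R x z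
          · simpa [h] using ih z
          · simp [h]
      _ = ν {y | R x y} * (κ ^ k * b) := by
          rw [lintegral_mul_const _ (hx x)]
          congr 1
          have hs : MeasurableSet {y | R x y} :=
            hRm.preimage (f := fun z => (x, z)) (by fun_prop)
          rw [← lintegral_indicator_one hs]
          refine lintegral_congr fun z => ?_
          simp [Set.indicator_apply]
      _ ≤ κ * (κ ^ k * b) := mul_le_mul_left (hκ x) _
      _ = κ ^ (k + 1) * b := by ring

/-- The bound on the correlation between two families of pinned particles. -/
def correlationBound (R : E → E → Prop) (ν : Measure E) (m : ℝ≥0∞) {ι ι' : Type} [Fintype ι]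
    [Fintype ι'] (X : ι → E) (X' : ι' → E) : ℝ≥0∞ :=
  ∑ i, ∑ j, ∑' k : ℕ, (2 * m) ^ k * chainKernel R ν k (X i) (X' j)

lemma measurable_correlationBound {R : E → E → Prop}
    (hRm : MeasurableSet {p : E × E | R p.1 p.2}) (ν : Measure E) [SigmaFinite ν] (m : ℝ≥0∞)
    (ι ι' : Type) [Fintype ι] [Fintype ι'] :
    Measurable fun p : (ι → E) × (ι' → E) => correlationBound R ν m p.1 p.2 := by
  refine Finset.measurable_fun_sum _ fun i _ => Finset.measurable_fun_sum _ fun j _ =>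
    Measurable.tsum fun k => Measurable.const_mul ?_ _
  exact (measurable_chainKernel hRm ν k).comp
    (by fun_prop : Measurable fun p : (ι → E) × (ι' → E) => (p.1 i, p.2 j))

lemma lintegral_correlationBound_le {R : E → E → Prop}
    (hRm : MeasurableSet {p : E × E | R p.1 p.2}) (ν : Measure E) [SigmaFinite ν]
    {m κ a b : ℝ≥0∞} (hκ : ∀ x, ν {y | R x y} ≤ κ) (hmκ : 2 * m * κ ≤ 2⁻¹)
    {ι : Type} [Fintype ι] {f : (ι → E) → ℝ≥0∞}
    (hf : Measurable f) (ha : ∫⁻ X, f X ∂iid ν ι ≤ a)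
    (hb : ∀ x j, ∫⁻ X, f X * (if R x (X j) then 1 else 0) ∂iid ν ι ≤ b) :
    ∫⁻ X, ∫⁻ X', f X * f X' * correlationBound R ν m X X' ∂iid ν ι ∂iid ν ι ≤
      2 * (Fintype.card ι : ℝ≥0∞) ^ 2 * a * b := by
  have hKm := measurable_chainKernel hRm ν
  have hin : ∀ X, ∫⁻ X', f X * f X' * correlationBound R ν m X X' ∂iid ν ι ≤
      f X * (2 * (Fintype.card ι : ℝ≥0∞) ^ 2 * b) := by
    intro X
    have e : ∀ X', f X * f X' * correlationBound R ν m X X' =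
        f X * ∑ i, ∑ j, ∑' k : ℕ, (2 * m) ^ k * (f X' * chainKernel R ν k (X i) (X' j)) := by
      intro X'
      rw [correlationBound, mul_assoc, Finset.mul_sum]
      congr 1
      refine Finset.sum_congr rfl fun i _ => ?_
      rw [Finset.mul_sum]
      refine Finset.sum_congr rfl fun j _ => ?_
      rw [← ENNReal.tsum_mul_left]
      refine tsum_congr fun k => ?_
      ring
    have hm : ∀ i j k, Measurable fun X' : ι → E =>
        (2 * m) ^ k * (f X' * chainKernel R ν k (X i) (X' j)) := fun i j k =>
      (hf.mul ((hKm k).comp (by fun_prop : Measurable fun X' : ι → E => (X i, X' j)))).const_mul _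
    simp_rw [e]
    rw [lintegral_const_mul _ (Finset.measurable_fun_sum _ fun i _ =>
      Finset.measurable_fun_sum _ fun j _ => Measurable.tsum fun k => hm i j k)]
    refine mul_le_mul_right ?_ _
    rw [lintegral_finsetSum _ fun i _ =>
      Finset.measurable_fun_sum _ fun j _ => Measurable.tsum fun k => hm i j k]
    have hij : ∀ i, ∫⁻ X', ∑ j, ∑' k : ℕ, (2 * m) ^ k *
        (f X' * chainKernel R ν k (X i) (X' j)) ∂iid ν ι ≤ (Fintype.card ι : ℝ≥0∞) * (2 * b) := by
      intro i
      rw [lintegral_finsetSum _ fun j _ => Measurable.tsum fun k => hm i j k]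
      have : ∀ j ∈ Finset.univ, ∫⁻ X', ∑' k : ℕ, (2 * m) ^ k *
          (f X' * chainKernel R ν k (X i) (X' j)) ∂iid ν ι ≤ 2 * b := by
        intro j _
        rw [lintegral_tsum fun k => (hm i j k).aemeasurable]
        calc ∑' k : ℕ, ∫⁻ X', (2 * m) ^ k * (f X' * chainKernel R ν k (X i) (X' j)) ∂iid ν ι
            ≤ ∑' k : ℕ, 2⁻¹ ^ k * b := by
              refine ENNReal.tsum_le_tsum fun k => ?_
              rw [lintegral_const_mul _ (show Measurable fun X' : ι → E =>
                f X' * chainKernel R ν k (X i) (X' j) from hf.mul ((hKm k).comp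
                  (by fun_prop : Measurable fun X' : ι → E => (X i, X' j))))]
              calc _ ≤ (2 * m) ^ k * (κ ^ k * b) := mul_le_mul_right
                    (lintegral_mul_chainKernel_le hRm ν hκ hf j (fun x => hb x j) k (X i)) _
                _ = (2 * m * κ) ^ k * b := by rw [mul_pow (2 * m)]; ring
                _ ≤ _ := by gcongr
          _ = 2 * b := by
              rw [ENNReal.tsum_mul_right, ENNReal.tsum_geometric, ENNReal.one_sub_inv_two, inv_inv]
      refine (Finset.sum_le_sum this).trans ?_
      simp
    refine (Finset.sum_le_sum fun i _ => hij i).trans ?_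
    simp only [Finset.sum_const, Finset.card_univ, nsmul_eq_mul]
    exact le_of_eq (by ring)
  calc _ ≤ ∫⁻ X, f X * (2 * (Fintype.card ι : ℝ≥0∞) ^ 2 * b) ∂iid ν ι := lintegral_mono hin
    _ = (∫⁻ X, f X ∂iid ν ι) * (2 * (Fintype.card ι : ℝ≥0∞) ^ 2 * b) :=
        lintegral_mul_const _ hf
    _ ≤ a * (2 * (Fintype.card ι : ℝ≥0∞) ^ 2 * b) := mul_le_mul_left ha _
    _ = _ := by ring

lemma grandSum_colourWeight {R : E → E → Prop} (hRm : MeasurableSet {p : E × E | R p.1 p.2})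
    (m : ℝ≥0∞) (ν : Measure E) [SigmaFinite ν] :
    grandSum m ν (colourWeight R) =
      grandSum m ν (hardCoreWeight R) * grandSum m ν (hardCoreWeight R) := by
  rw [grandSum_mul m ν (isWeight_hardCoreWeight hRm) (isWeight_hardCoreWeight hRm), grandSum]
  refine tsum_congr fun n => ?_
  congr 1
  refine lintegral_congr fun Y => ?_
  rw [colourWeight, tsum_fintype]
  refine Finset.sum_congr rfl fun s _ => ?_
  simp only [hardCoreWeight, properColouring_iff, ite_one_mul_ite_one]

lemma tsum_colourWeight_mul_chainCount_le {R : E → E → Prop}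
    (hRm : MeasurableSet {p : E × E | R p.1 p.2}) (m : ℝ≥0∞) (ν : Measure E) [SigmaFinite ν]
    {ι ι' : Type} [Fintype ι] [Fintype ι'] (X : ι → E) (X' : ι' → E) :
    ∑' n : ℕ, m ^ n / (n.factorial : ℝ≥0∞) * ∫⁻ Y : Fin n → E,
        colourWeight R (Fin n) Y * chainCount R X X' Y ∂iid ν (Fin n) ≤
      grandSum m ν (hardCoreWeight R) * grandSum m ν (hardCoreWeight R) *
        correlationBound R ν m X X' := by
  have hw := isWeight_colourWeight hRm
  have hc : ∀ i j k, Measurable fun z : Fin k → E =>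
      if Chain R (X i) (List.ofFn z) (X' j) then (1 : ℝ≥0∞) else 0 := fun i j k =>
    measurable_ite_one ((measurableSet_chain hRm k).preimage
      (f := fun z : Fin k → E => (X i, z, X' j)) (by fun_prop))
  have hm : ∀ n i j k, Measurable fun Y : Fin n → E => colourWeight R (Fin n) Y *
      ∑ f : Fin k ↪ Fin n, if Chain R (X i) (List.ofFn (Y ∘ f)) (X' j) then 1 else 0 :=
    fun n i j k => (hw.measurable _).mul (Finset.measurable_fun_sum _ fun f _ =>
      (hc i j k).comp (by fun_prop : Measurable fun Y : Fin n → E => Y ∘ f))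
  have hexp : ∀ n, ∫⁻ Y : Fin n → E, colourWeight R (Fin n) Y * chainCount R X X' Y
      ∂iid ν (Fin n) = ∑ i, ∑ j, ∑' k : ℕ, ∫⁻ Y : Fin n → E, colourWeight R (Fin n) Y *
        ∑ f : Fin k ↪ Fin n, (if Chain R (X i) (List.ofFn (Y ∘ f)) (X' j) then 1 else 0)
          ∂iid ν (Fin n) := by
    intro n
    simp_rw [chainCount, Finset.mul_sum, ← ENNReal.tsum_mul_left]
    have hm' : ∀ i j k, Measurable fun Y : Fin n → E => ∑ f : Fin k ↪ Fin n,
        colourWeight R (Fin n) Y *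
          if Chain R (X i) (List.ofFn (Y ∘ f)) (X' j) then 1 else 0 := fun i j k => by
      simpa only [Finset.mul_sum] using hm n i j k
    rw [lintegral_finsetSum _ fun i _ => Finset.measurable_fun_sum _ fun j _ =>
      Measurable.tsum fun k => by simpa only [Finset.mul_sum] using hm' i j k]
    refine Finset.sum_congr rfl fun i _ => ?_
    rw [lintegral_finsetSum _ fun j _ =>
      Measurable.tsum fun k => by simpa only [Finset.mul_sum] using hm' i j k]
    refine Finset.sum_congr rfl fun j _ => ?_
    rw [lintegral_tsum fun k => by simpa only [Finset.mul_sum] using (hm' i j k).aemeasurable]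
    simp only [Finset.mul_sum]
  simp_rw [hexp, Finset.mul_sum, ← ENNReal.tsum_mul_left]
  rw [Summable.tsum_finsetSum fun _ _ => ENNReal.summable]
  simp_rw [correlationBound, Finset.mul_sum]
  refine Finset.sum_le_sum fun i _ => ?_
  rw [Summable.tsum_finsetSum fun _ _ => ENNReal.summable]
  refine Finset.sum_le_sum fun j _ => ?_
  rw [ENNReal.tsum_comm, ← ENNReal.tsum_mul_left]
  refine ENNReal.tsum_le_tsum fun k => ?_
  have hC := campbell m ν hw (ι := Fin k)
    (Ψ := fun z => if Chain R (X i) (List.ofFn z) (X' j) then 1 else 0) (hc i j k)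
  simp_rw [Finset.mul_sum] at hC
  rw [hC, Fintype.card_fin, chainKernel]
  calc _ ≤ m ^ k * ∫⁻ z : Fin k → E, (if Chain R (X i) (List.ofFn z) (X' j) then 1 else 0) *
        (2 ^ k * grandSum m ν (colourWeight R)) ∂iid ν (Fin k) := by
        refine mul_le_mul_right (lintegral_mono fun z => mul_le_mul_right ?_ _) _
        rw [grandSum, grandSum, ← ENNReal.tsum_mul_left]
        refine ENNReal.tsum_le_tsum fun n => ?_
        rw [mul_left_comm, ← lintegral_const_mul _ (hw.measurable _)]
        refine mul_le_mul_right (lintegral_mono fun Y => ?_) _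
        have := colourWeight_sumElim_le R z Y
        rwa [Fintype.card_fin] at this
    _ = _ := by
        rw [lintegral_mul_const _ (hc i j k), grandSum_colourWeight hRm, mul_pow]
        ring

lemma grandSum_mul_grandSum_pinned {R : E → E → Prop}
    (hRm : MeasurableSet {p : E × E | R p.1 p.2}) (m : ℝ≥0∞) (ν : Measure E) [SigmaFinite ν]
    {ι ι' : Type} [Fintype ι] [Fintype ι'] (X : ι → E) (X' : ι' → E) :
    grandSum m ν (hardCoreWeight R) * grandSum m ν (pinned (hardCoreWeight R) (Sum.elim X X')) =
      ∑' n : ℕ, m ^ n / (n.factorial : ℝ≥0∞) * ∫⁻ Y : Fin n → E, ∑ s : Finset (Fin n),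
        (if JointColouring R X X' Y s then 1 else 0) ∂iid ν (Fin n) := by
  have hw := isWeight_hardCoreWeight hRm
  rw [grandSum_mul m ν hw (hw.pinned _)]
  refine tsum_congr fun n => ?_
  congr 1
  refine lintegral_congr fun Y => Finset.sum_congr rfl fun s _ => ?_
  simp only [pinned, hardCoreWeight, ite_one_mul_ite_one]
  exact if_congr Iff.rfl rfl rfl

lemma grandSum_pinned_mul_grandSum_pinned {R : E → E → Prop}
    (hRm : MeasurableSet {p : E × E | R p.1 p.2}) (m : ℝ≥0∞) (ν : Measure E) [SigmaFinite ν]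
    {ι ι' : Type} [Fintype ι] [Fintype ι'] (X : ι → E) (X' : ι' → E) :
    grandSum m ν (pinned (hardCoreWeight R) X) * grandSum m ν (pinned (hardCoreWeight R) X') =
      ∑' n : ℕ, m ^ n / (n.factorial : ℝ≥0∞) * ∫⁻ Y : Fin n → E, ∑ s : Finset (Fin n),
        (if SplitColouring R X X' Y s then 1 else 0) ∂iid ν (Fin n) := by
  have hw := isWeight_hardCoreWeight hRm
  rw [grandSum_mul m ν (hw.pinned _) (hw.pinned _)]
  refine tsum_congr fun n => ?_
  congr 1
  refine lintegral_congr fun Y => Finset.sum_congr rfl fun s _ => ?_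
  simp only [pinned, hardCoreWeight, ite_one_mul_ite_one]
  exact if_congr Iff.rfl rfl rfl

lemma tsum_le_add_of_forall_le {m : ℝ≥0∞} {ν : Measure E} [SigmaFinite ν] 
    {f g h : ∀ n : ℕ, (Fin n → E) → ℝ≥0∞} {c : ℝ≥0∞} (hg : ∀ n, Measurable (g n))
    (hle : ∀ n Y, f n Y ≤ g n Y + h n Y)
    (hh : ∑' n : ℕ, m ^ n / (n.factorial : ℝ≥0∞) * ∫⁻ Y, h n Y ∂iid ν (Fin n) ≤ c) :
    ∑' n : ℕ, m ^ n / (n.factorial : ℝ≥0∞) * ∫⁻ Y, f n Y ∂iid ν (Fin n) ≤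
      ∑' n : ℕ, m ^ n / (n.factorial : ℝ≥0∞) * ∫⁻ Y, g n Y ∂iid ν (Fin n) + c := by
  refine le_trans ?_ (add_le_add_right hh _)
  rw [← ENNReal.tsum_add]
  refine ENNReal.tsum_le_tsum fun n => ?_
  rw [← mul_add, ← lintegral_add_left (hg n)]
  exact mul_le_mul_right (lintegral_mono (hle n)) _

lemma measurableSet_jointColouring {R : E → E → Prop}
    (hRm : MeasurableSet {p : E × E | R p.1 p.2}) {ι ι' κ : Type} [Finite ι] [Finite ι'] [Finite κ]
    (X : ι → E) (X' : ι' → E) (s : Finset κ) :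
    MeasurableSet {Y : κ → E | JointColouring R X X' Y s} := by
  refine MeasurableSet.inter ((measurableSet_indep hRm _).preimage (by fun_prop))
    ((measurableSet_indep hRm _).preimage ?_)
  exact measurable_sumElim.comp (measurable_const.prodMk (by fun_prop))

lemma measurableSet_splitColouring {R : E → E → Prop}
    (hRm : MeasurableSet {p : E × E | R p.1 p.2}) {ι ι' κ : Type} [Finite ι] [Finite ι'] [Finite κ]
    (X : ι → E) (X' : ι' → E) (s : Finset κ) :
    MeasurableSet {Y : κ → E | SplitColouring R X X' Y s} := by
  refine MeasurableSet.inter ((measurableSet_indep hRm _).preimage ?_)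
    ((measurableSet_indep hRm _).preimage ?_) <;>
  exact measurable_sumElim.comp (measurable_const.prodMk (by fun_prop))

/-- Decorrelation of two pinned families, upper bound. -/
theorem joint_le_split_add {R : E → E → Prop} (hR : ∀ x y, R x y → R y x)
    (hRm : MeasurableSet {p : E × E | R p.1 p.2}) (m : ℝ≥0∞) (ν : Measure E) [SigmaFinite ν]
    {ι ι' : Type} [Fintype ι] [Fintype ι'] (X : ι → E) (X' : ι' → E) :
    grandSum m ν (hardCoreWeight R) * grandSum m ν (pinned (hardCoreWeight R) (Sum.elim X X')) ≤
      grandSum m ν (pinned (hardCoreWeight R) X) * grandSum m ν (pinned (hardCoreWeight R) X') +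
        grandSum m ν (hardCoreWeight R) * grandSum m ν (hardCoreWeight R) *
          correlationBound R ν m X X' := by
  rw [grandSum_mul_grandSum_pinned hRm, grandSum_pinned_mul_grandSum_pinned hRm]
  exact tsum_le_add_of_forall_le (fun n => Finset.measurable_fun_sum _ fun s _ =>
    measurable_ite_one (measurableSet_splitColouring hRm X X' s))
    (fun n Y => sum_jointColouring_le hR X X' Y) (tsum_colourWeight_mul_chainCount_le hRm m ν X X')

/-- Decorrelation of two pinned families, lower bound. -/
theorem split_le_joint_add {R : E → E → Prop} (hR : ∀ x y, R x y → R y x)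
    (hRm : MeasurableSet {p : E × E | R p.1 p.2}) (m : ℝ≥0∞) (ν : Measure E) [SigmaFinite ν]
    {ι ι' : Type} [Fintype ι] [Fintype ι'] (X : ι → E) (X' : ι' → E) :
    grandSum m ν (pinned (hardCoreWeight R) X) * grandSum m ν (pinned (hardCoreWeight R) X') ≤
      grandSum m ν (hardCoreWeight R) * grandSum m ν (pinned (hardCoreWeight R) (Sum.elim X X')) +
        grandSum m ν (hardCoreWeight R) * grandSum m ν (hardCoreWeight R) *
          correlationBound R ν m X X' := by
  rw [grandSum_mul_grandSum_pinned hRm, grandSum_pinned_mul_grandSum_pinned hRm]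
  exact tsum_le_add_of_forall_le (fun n => Finset.measurable_fun_sum _ fun s _ =>
    measurable_ite_one (measurableSet_jointColouring hRm X X' s))
    (fun n Y => sum_splitColouring_le hR X X' Y) (tsum_colourWeight_mul_chainCount_le hRm m ν X X')

end Decorrelation

section Gibbs

variable {E : Type*} [MeasurableSpace E]

lemma measurable_sigma_iff {α : ℕ → Type*} [∀ n, MeasurableSpace (α n)] {β : Type*}
    [MeasurableSpace β] {f : (Σ n, α n) → β} :
    Measurable f ↔ ∀ n, Measurable fun y : α n => f ⟨n, y⟩ := by
  constructor
  · intro h n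
    exact h.comp fun s hs => (MeasurableSpace.measurableSet_iInf.1 hs n)
  · intro h s hs
    exact MeasurableSpace.measurableSet_iInf.2 fun n => h n hs

lemma measurable_sigmaMk {α : ℕ → Type*} [∀ n, MeasurableSpace (α n)] (n : ℕ) :
    Measurable (Sigma.mk n : α n → Σ n, α n) :=
  measurable_sigma_iff.1 measurable_id n

/-- The unnormalised grand canonical measure with weight `w` at activity `m`. -/
def gibbs (m : ℝ≥0∞) (ν : Measure E) (w : ∀ ι : Type, (ι → E) → ℝ≥0∞) :
    Measure (Σ n : ℕ, (Fin n → E)) :=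
  Measure.sum fun n => (m ^ n / (n.factorial : ℝ≥0∞)) •
    ((iid ν (Fin n)).withDensity (w (Fin n))).map (Sigma.mk n)

lemma lintegral_gibbs {m : ℝ≥0∞} {ν : Measure E} {w : ∀ ι : Type, (ι → E) → ℝ≥0∞}
    (hw : IsWeight w) {f : (Σ n : ℕ, (Fin n → E)) → ℝ≥0∞} (hf : Measurable f) :
    ∫⁻ ω, f ω ∂gibbs m ν w = ∑' n : ℕ, m ^ n / (n.factorial : ℝ≥0∞) *
      ∫⁻ Y : Fin n → E, w (Fin n) Y * f ⟨n, Y⟩ ∂iid ν (Fin n) := by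
  rw [gibbs, lintegral_sum_measure]
  refine tsum_congr fun n => ?_
  rw [lintegral_smul_measure, lintegral_map hf (measurable_sigmaMk n),
    lintegral_withDensity_eq_lintegral_mul _ (hw.measurable _)
      (show Measurable fun Y => f ⟨n, Y⟩ from hf.comp (measurable_sigmaMk n))]
  rfl

lemma gibbs_univ {m : ℝ≥0∞} {ν : Measure E} {w : ∀ ι : Type, (ι → E) → ℝ≥0∞}
    (hw : IsWeight w) : gibbs m ν w Set.univ = grandSum m ν w := by
  rw [← lintegral_one, lintegral_gibbs hw measurable_const]
  simp [grandSum]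

/-- The sum of `Ψ` over all tuples of distinct particles. -/
def tupleSum {M : Type*} [AddCommMonoid M] {ι : Type} [Fintype ι] (Ψ : (ι → E) → M)
    (ω : Σ n : ℕ, (Fin n → E)) : M :=
  ∑ f : ι ↪ Fin ω.1, Ψ (ω.2 ∘ f)

lemma measurable_tupleSum {M : Type*} [AddCommMonoid M] [MeasurableSpace M] [MeasurableAdd₂ M]
    {ι : Type} [Fintype ι] {Ψ : (ι → E) → M} (hΨ : Measurable Ψ) : Measurable (tupleSum Ψ) := by
  refine measurable_sigma_iff.2 fun n => ?_
  change Measurable fun Y : Fin n → E => ∑ f : ι ↪ Fin n, Ψ (Y ∘ f)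
  refine Finset.measurable_fun_sum _ fun f _ => ?_
  exact hΨ.comp (by fun_prop : Measurable fun Y : Fin n → E => Y ∘ f)

lemma lintegral_tupleSum {m : ℝ≥0∞} {ν : Measure E} [SigmaFinite ν]
    {w : ∀ ι : Type, (ι → E) → ℝ≥0∞} (hw : IsWeight w) {ι : Type} [Fintype ι]
    {Ψ : (ι → E) → ℝ≥0∞} (hΨ : Measurable Ψ) :
    ∫⁻ ω, tupleSum Ψ ω ∂gibbs m ν w =
      m ^ Fintype.card ι * ∫⁻ X, Ψ X * grandSum m ν (pinned w X) ∂iid ν ι := by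
  rw [lintegral_gibbs hw (measurable_tupleSum hΨ), ← campbell m ν hw hΨ]
  rfl

lemma enorm_tupleSum_le {E : Type*} {ι : Type} [Fintype ι] (Ψ : (ι → E) → ℝ) (ω : Σ n : ℕ, (Fin n → E)) :
    ‖tupleSum Ψ ω‖ₑ ≤ tupleSum (fun X => ‖Ψ X‖ₑ) ω :=
  enorm_sum_le _ _

variable {m : ℝ≥0∞} {ν : Measure E} [SigmaFinite ν] {w : ∀ ι : Type, (ι → E) → ℝ≥0∞}

lemma integrable_tupleSum (hw : IsWeight w) (hm : m ≠ ∞)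
    {ι : Type} [Fintype ι] {c : ℝ≥0∞} (hc : c ≠ ∞)
    (hg : ∀ X : ι → E, grandSum m ν (pinned w X) ≤ c) {Ψ : (ι → E) → ℝ} (hΨ : Measurable Ψ)
    (hi : ∫⁻ X, ‖Ψ X‖ₑ ∂iid ν ι ≠ ∞) : Integrable (tupleSum Ψ) (gibbs m ν w) := by
  refine ⟨(measurable_tupleSum hΨ).aestronglyMeasurable, ?_⟩
  refine lt_of_le_of_lt (lintegral_mono (enorm_tupleSum_le Ψ)) ?_
  rw [lintegral_tupleSum hw hΨ.enorm]
  refine ENNReal.mul_lt_top (ENNReal.pow_lt_top hm.lt_top) ?_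
  calc _ ≤ ∫⁻ X, ‖Ψ X‖ₑ * c ∂iid ν ι := lintegral_mono fun X => mul_le_mul_right (hg X) _
    _ = (∫⁻ X, ‖Ψ X‖ₑ ∂iid ν ι) * c := lintegral_mul_const _ hΨ.enorm
    _ < ∞ := ENNReal.mul_lt_top hi.lt_top hc.lt_top

lemma integrable_mul_toReal {α : Type*} [MeasurableSpace α] {P : Measure α} {g : α → ℝ≥0∞}
    (hgm : Measurable g) {c : ℝ≥0∞} (hc : c ≠ ∞) (hg : ∀ x, g x ≤ c) {Ψ : α → ℝ}
    (hΨ : Measurable Ψ) (hi : ∫⁻ X, ‖Ψ X‖ₑ ∂P ≠ ∞) :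
    Integrable (fun X => Ψ X * (g X).toReal) P := by
  have hI : Integrable Ψ P := ⟨hΨ.aestronglyMeasurable, hi.lt_top⟩
  refine hI.mul_bdd (c := c.toReal) hgm.ennreal_toReal.aestronglyMeasurable
    (Filter.Eventually.of_forall fun X => ?_)
  rw [Real.norm_of_nonneg ENNReal.toReal_nonneg]
  exact ENNReal.toReal_mono hc (hg X)

lemma integral_tupleSum (hw : IsWeight w) (hm : m ≠ ∞)
    {ι : Type} [Fintype ι] {c : ℝ≥0∞} (hc : c ≠ ∞)
    (hg : ∀ X : ι → E, grandSum m ν (pinned w X) ≤ c) {Ψ : (ι → E) → ℝ} (hΨ : Measurable Ψ)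
    (hi : ∫⁻ X, ‖Ψ X‖ₑ ∂iid ν ι ≠ ∞) :
    ∫ ω, tupleSum Ψ ω ∂gibbs m ν w =
      m.toReal ^ Fintype.card ι * ∫ X, Ψ X * (grandSum m ν (pinned w X)).toReal ∂iid ν ι := by
  have hgm := measurable_grandSum_pinned (m := m) (ν := ν) hw ι
  have pos : ∀ {Θ : (ι → E) → ℝ}, Measurable Θ → (∀ X, 0 ≤ Θ X) →
      ∫ ω, tupleSum Θ ω ∂gibbs m ν w =
      m.toReal ^ Fintype.card ι * ∫ X, Θ X * (grandSum m ν (pinned w X)).toReal ∂iid ν ι := by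
    intro Θ hΘ h0
    rw [integral_eq_lintegral_of_nonneg_ae (Filter.Eventually.of_forall fun ω =>
        show 0 ≤ tupleSum Θ ω from Finset.sum_nonneg fun f _ => h0 _) (measurable_tupleSum hΘ).aestronglyMeasurable,
      integral_eq_lintegral_of_nonneg_ae (Filter.Eventually.of_forall fun X =>
        mul_nonneg (h0 X) ENNReal.toReal_nonneg)
        (hΘ.mul hgm.ennreal_toReal).aestronglyMeasurable]
    have e1 : ∀ ω, ENNReal.ofReal (tupleSum Θ ω) = tupleSum (fun X => ENNReal.ofReal (Θ X)) ω :=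
      fun ω => ENNReal.ofReal_sum_of_nonneg fun f _ => h0 _
    have e2 : ∀ X, ENNReal.ofReal (Θ X * (grandSum m ν (pinned w X)).toReal) =
        ENNReal.ofReal (Θ X) * grandSum m ν (pinned w X) := fun X => by
      rw [ENNReal.ofReal_mul (h0 X), ENNReal.ofReal_toReal (ne_top_of_le_ne_top hc (hg X))]
    simp_rw [e1, e2]
    rw [lintegral_tupleSum hw hΘ.ennreal_ofReal, ENNReal.toReal_mul, ENNReal.toReal_pow]
  have hpm : Measurable fun X => max (Ψ X) 0 := hΨ.max measurable_const
  have hnm : Measurable fun X => max (-Ψ X) 0 := hΨ.neg.max measurable_const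
  have hple : ∀ X, ‖max (Ψ X) 0‖ₑ ≤ ‖Ψ X‖ₑ := fun X => by
    rw [enorm_le_iff_norm_le, Real.norm_of_nonneg (le_max_right _ _)]
    exact max_le (le_abs_self _) (abs_nonneg _)
  have hnle : ∀ X, ‖max (-Ψ X) 0‖ₑ ≤ ‖Ψ X‖ₑ := fun X => by
    rw [enorm_le_iff_norm_le, Real.norm_of_nonneg (le_max_right _ _)]
    exact max_le (neg_le_abs _) (abs_nonneg _)
  have hpi := ne_top_of_le_ne_top hi (lintegral_mono hple)
  have hni := ne_top_of_le_ne_top hi (lintegral_mono hnle)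
  have hsub : ∀ X, Ψ X = max (Ψ X) 0 - max (-Ψ X) 0 := fun X => by
    rcases le_total (Ψ X) 0 with h | h
    · rw [max_eq_right h, max_eq_left (by linarith)]; ring
    · rw [max_eq_left h, max_eq_right (by linarith)]; ring
  calc ∫ ω, tupleSum Ψ ω ∂gibbs m ν w
      = ∫ ω, (tupleSum (fun X => max (Ψ X) 0) ω - tupleSum (fun X => max (-Ψ X) 0) ω)
          ∂gibbs m ν w := by
        refine integral_congr_ae (Filter.Eventually.of_forall fun ω => ?_)
        simp only [tupleSum, ← Finset.sum_sub_distrib]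
        exact Finset.sum_congr rfl fun f _ => hsub _
    _ = _ := by
        rw [integral_sub (integrable_tupleSum hw hm hc hg hpm hpi)
          (integrable_tupleSum hw hm hc hg hnm hni), pos hpm (fun _ => le_max_right _ _),
          pos hnm (fun _ => le_max_right _ _), ← mul_sub, ← integral_sub
          (integrable_mul_toReal hgm hc hg hpm hpi) (integrable_mul_toReal hgm hc hg hnm hni)]
        congr 1
        refine integral_congr_ae (Filter.Eventually.of_forall fun X => ?_)
        simp only [← sub_mul, ← hsub]

end Gibbs

section Overlap

/-- Two tuples whose overlap pattern is `t` are jointly parametrised by the first tuple and the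
entries of the second one left free by `t`. -/
def glueIdx {ι : Type} (t : ι → Option ι) (i : ι) : ι ⊕ {i // t i = none} :=
  match h : t i with
  | some a => Sum.inl a
  | none => Sum.inr ⟨i, h⟩

lemma glueIdx_of_eq_some {ι : Type} {t : ι → Option ι} {i a : ι} (h : t i = some a) :
    glueIdx t i = Sum.inl a := by
  unfold glueIdx
  split
  · simp_all
  · simp_all

lemma glueIdx_of_eq_none {ι : Type} {t : ι → Option ι} {i : ι} (h : t i = none) :
    glueIdx t i = Sum.inr ⟨i, h⟩ := by
  unfold glueIdx
  split
  · simp_all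
  · rfl

/-- The nontrivial overlap patterns of two tuples of distinct particles. -/
def overlapTypes (ι : Type) [Fintype ι] : Finset (ι → Option ι) :=
  {t | Function.Injective (glueIdx t) ∧ ∃ i, t i ≠ none}

lemma exists_overlapType {ι κ : Type} [Fintype ι] (f g : ι ↪ κ)
    (hfg : ¬ Disjoint (Set.range f) (Set.range g)) :
    ∃ t ∈ overlapTypes ι, ∃ h : ι ⊕ {i // t i = none} ↪ κ, f = h ∘ Sum.inl ∧
      g = h ∘ glueIdx t := by
  let t : ι → Option ι := fun i => if h : ∃ a, f a = g i then some h.choose else none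
  have ht1 : ∀ {i a}, t i = some a → f a = g i := by
    intro i a h
    by_cases he : ∃ a, f a = g i
    · simp only [t, he, dif_pos, Option.some.injEq] at h
      exact h ▸ he.choose_spec
    · simp [t, he] at h
  have ht2 : ∀ {i}, t i = none → ∀ a, f a ≠ g i := by
    intro i h a ha
    have : ∃ a, f a = g i := ⟨a, ha⟩
    simp [t, this] at h
  have hinj : Function.Injective
      (Sum.elim f fun i : {i // t i = none} => g i : ι ⊕ {i // t i = none} → κ) :=
    f.injective.sumElim (g.injective.comp Subtype.val_injective) fun a i => ht2 i.2 a
  have hg : (g : ι → κ) = (Sum.elim f fun i : {i // t i = none} => g i) ∘ glueIdx t := by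
    funext i
    rw [Function.comp_apply]
    cases h : t i with
    | some a => rw [glueIdx_of_eq_some h]; exact (ht1 h).symm
    | none => rw [glueIdx_of_eq_none h]; rfl
  refine ⟨t, ?_, ⟨_, hinj⟩, rfl, hg⟩
  simp only [overlapTypes, Finset.mem_filter, Finset.mem_univ, true_and]
  refine ⟨Function.Injective.of_comp (hg ▸ g.injective), ?_⟩
  by_contra hn
  push Not at hn
  refine hfg (Set.disjoint_left.2 ?_)
  rintro _ ⟨a, rfl⟩ ⟨i, hi⟩
  exact ht2 (hn i) a hi.symm

lemma sum_overlapping_le {ι κ : Type} [Fintype ι] [Fintype κ]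
    (c : (ι → κ) → (ι → κ) → ℝ≥0∞) :
    ∑ p : (ι ↪ κ) × (ι ↪ κ) with ¬ Disjoint (Set.range p.1) (Set.range p.2), c p.1 p.2 ≤
      ∑ t ∈ overlapTypes ι, ∑ h : ι ⊕ {i // t i = none} ↪ κ, c (h ∘ Sum.inl) (h ∘ glueIdx t) := by
  choose T hT H hH1 hH2 using fun p : {p : (ι ↪ κ) × (ι ↪ κ) //
    ¬ Disjoint (Set.range p.1) (Set.range p.2)} => exists_overlapType p.1.1 p.1.2 p.2
  let s : {p : (ι ↪ κ) × (ι ↪ κ) // ¬ Disjoint (Set.range p.1) (Set.range p.2)} →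
      Σ t : overlapTypes ι, ι ⊕ {i // t.1 i = none} ↪ κ := fun p => ⟨⟨T p, hT p⟩, H p⟩
  let c' : (Σ t : overlapTypes ι, ι ⊕ {i // t.1 i = none} ↪ κ) → ℝ≥0∞ := fun σ =>
    c (σ.2 ∘ Sum.inl) (σ.2 ∘ glueIdx σ.1.1)
  have hs : Function.Injective s := by
    intro p q hpq
    have h1 : ∀ σ σ' : Σ t : overlapTypes ι, ι ⊕ {i // t.1 i = none} ↪ κ, σ = σ' →
        σ.2 ∘ Sum.inl = σ'.2 ∘ Sum.inl ∧ σ.2 ∘ glueIdx σ.1.1 = σ'.2 ∘ glueIdx σ'.1.1 := by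
      rintro σ _ rfl
      exact ⟨rfl, rfl⟩
    have h2 := h1 _ _ hpq
    refine Subtype.ext (Prod.ext (DFunLike.coe_injective ?_) (DFunLike.coe_injective ?_))
    · rw [hH1 p, hH1 q]
      exact h2.1
    · rw [hH2 p, hH2 q]
      exact h2.2
  calc _ = ∑' p, c' (s p) := by
        rw [tsum_fintype, Finset.sum_subtype (p := fun p : (ι ↪ κ) × (ι ↪ κ) =>
          ¬ Disjoint (Set.range p.1) (Set.range p.2)) _ (by simp)]
        refine Finset.sum_congr (by congr) fun p _ => ?_
        change c p.1.1 p.1.2 = c (H p ∘ Sum.inl) (H p ∘ glueIdx (T p))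
        rw [← hH1 p, ← hH2 p]
    _ ≤ ∑' σ, c' σ := ENNReal.tsum_comp_le_tsum_of_injective hs c'
    _ = _ := by
        rw [ENNReal.tsum_sigma', tsum_fintype, ← Finset.sum_coe_sort (overlapTypes ι)]
        exact Finset.sum_congr (by congr) fun t _ => tsum_fintype _

end Overlap

section Variance

variable {E : Type*} [MeasurableSpace E]

lemma grandSum_pinned_hardCoreWeight_le (R : E → E → Prop) (m : ℝ≥0∞) (ν : Measure E)
    {ι : Type} (X : ι → E) :
    grandSum m ν (pinned (hardCoreWeight R) X) ≤ grandSum m ν (hardCoreWeight R) := by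
  refine grandSum_mono fun n Y => ?_
  simp only [pinned, hardCoreWeight]
  by_cases h : Indep R (Sum.elim X Y)
  · have h' : Indep R Y := fun i j hij => h (Sum.inr i) (Sum.inr j) (by simpa using hij)
    rw [if_pos h, if_pos h']
  · simp [h]

lemma one_le_grandSum_hardCoreWeight (R : E → E → Prop) (m : ℝ≥0∞) (ν : Measure E)
    [SigmaFinite ν] : 1 ≤ grandSum m ν (hardCoreWeight R) := by
  refine le_trans (le_of_eq ?_) (ENNReal.le_tsum 0)
  have : ∀ Y : Fin 0 → E, hardCoreWeight R (Fin 0) Y = 1 := fun Y => by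
    simp [hardCoreWeight, Indep]
  simp [this, iid]

lemma grandSum_hardCoreWeight_ne_top (R : E → E → Prop) {m : ℝ≥0∞} (hm : m ≠ ∞) (ν : Measure E)
    [IsProbabilityMeasure ν] : grandSum m ν (hardCoreWeight R) ≠ ∞ := by
  have hle : grandSum m ν (hardCoreWeight R) ≤
      ∑' n : ℕ, ENNReal.ofReal (m.toReal ^ n / n.factorial) := by
    refine ENNReal.tsum_le_tsum fun n => ?_
    rw [ENNReal.ofReal_div_of_pos (by positivity), ENNReal.ofReal_pow ENNReal.toReal_nonneg,
      ENNReal.ofReal_toReal hm, ENNReal.ofReal_natCast]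
    refine mul_le_of_le_one_right zero_le ?_
    calc _ ≤ ∫⁻ _, 1 ∂iid ν (Fin n) := by
          refine lintegral_mono fun Y => ?_
          simp only [hardCoreWeight]
          split_ifs <;> simp
      _ = 1 := by simp [iid]
  refine ne_top_of_le_ne_top ?_ hle
  exact (Real.summable_pow_div_factorial m.toReal).tsum_ofReal_ne_top

lemma tupleSum_sq {E : Type*} {ι : Type} [Fintype ι] (Φ : (ι → E) → ℝ)
    (ω : Σ n : ℕ, (Fin n → E)) :
    tupleSum Φ ω ^ 2 = tupleSum (fun X : ι ⊕ ι → E => Φ (X ∘ Sum.inl) * Φ (X ∘ Sum.inr)) ω +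
      ∑ p : (ι ↪ Fin ω.1) × (ι ↪ Fin ω.1) with ¬ Disjoint (Set.range p.1) (Set.range p.2),
        Φ (ω.2 ∘ p.1) * Φ (ω.2 ∘ p.2) := by
  rw [sq, tupleSum, Finset.sum_mul_sum, ← Finset.sum_product', Finset.univ_product_univ,
    ← Finset.sum_filter_add_sum_filter_not _ (fun p : (ι ↪ Fin ω.1) × (ι ↪ Fin ω.1) =>
      Disjoint (Set.range p.1) (Set.range p.2))]
  congr 1
  rw [Finset.sum_subtype (p := fun p : (ι ↪ Fin ω.1) × (ι ↪ Fin ω.1) =>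
          Disjoint (Set.range p.1) (Set.range p.2)) _ (by simp), tupleSum]
  refine (Fintype.sum_equiv Equiv.sumEmbeddingEquivProdEmbeddingDisjoint _ _
    fun h => ?_).symm
  rfl

lemma enorm_tupleSum_sq_sub_le {E : Type*} {ι : Type} [Fintype ι] (Φ : (ι → E) → ℝ)
    (ω : Σ n : ℕ, (Fin n → E)) :
    ‖tupleSum Φ ω ^ 2 -
        tupleSum (fun X : ι ⊕ ι → E => Φ (X ∘ Sum.inl) * Φ (X ∘ Sum.inr)) ω‖ₑ ≤
      ∑ t ∈ overlapTypes ι, tupleSum (fun X : ι ⊕ {i // t i = none} → E =>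
        ‖Φ (X ∘ Sum.inl) * Φ (X ∘ glueIdx t)‖ₑ) ω := by
  rw [tupleSum_sq, add_sub_cancel_left]
  refine (enorm_sum_le _ _).trans ?_
  exact sum_overlapping_le fun f g => ‖Φ (ω.2 ∘ f) * Φ (ω.2 ∘ g)‖ₑ

lemma enorm_toReal_sub_le {a b c : ℝ≥0∞} (ha : a ≠ ∞) (hb : b ≠ ∞) (h1 : a ≤ b + c)
    (h2 : b ≤ a + c) : ‖a.toReal - b.toReal‖ₑ ≤ c := by
  rcases eq_or_ne c ∞ with rfl | hc
  · exact le_top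
  rw [← ofReal_norm]
  refine ENNReal.ofReal_le_of_le_toReal (abs_sub_le_iff.2 ⟨?_, ?_⟩)
  · have := ENNReal.toReal_mono (ENNReal.add_ne_top.2 ⟨hb, hc⟩) h1
    rw [ENNReal.toReal_add hb hc] at this
    linarith
  · have := ENNReal.toReal_mono (ENNReal.add_ne_top.2 ⟨ha, hc⟩) h2
    rw [ENNReal.toReal_add ha hc] at this
    linarith

lemma lintegral_enorm_tensor (ν : Measure E) [SigmaFinite ν] {ι κ : Type} [Fintype ι] [Fintype κ]
    {Φ : (ι → E) → ℝ} (hΦ : Measurable Φ) {Θ : (κ → E) → ℝ} (hΘ : Measurable Θ) :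
    ∫⁻ X : ι ⊕ κ → E, ‖Φ (X ∘ Sum.inl) * Θ (X ∘ Sum.inr)‖ₑ ∂iid ν (ι ⊕ κ) =
      (∫⁻ X, ‖Φ X‖ₑ ∂iid ν ι) * ∫⁻ X, ‖Θ X‖ₑ ∂iid ν κ := by
  rw [lintegral_iid_sum ν (by fun_prop)]
  simp only [enorm_mul, Sum.elim_comp_inl, Sum.elim_comp_inr]
  simp_rw [lintegral_const_mul _ hΘ.enorm]
  rw [lintegral_mul_const _ hΦ.enorm]

lemma integral_iid_sum (ν : Measure E) [SigmaFinite ν] {ι κ : Type} [Fintype ι] [Fintype κ]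
    (f : (ι ⊕ κ → E) → ℝ) :
    ∫ X, f X ∂iid ν (ι ⊕ κ) = ∫ p, f (Sum.elim p.1 p.2) ∂(iid ν ι).prod (iid ν κ) := by
  have h := (measurePreserving_sumPiEquivProdPi (fun _ : ι ⊕ κ => ν)).symm
  rw [← h.integral_comp (MeasurableEquiv.measurableEmbedding _)]
  rfl

lemma enorm_covariance_le {R : E → E → Prop} (hR : ∀ x y, R x y → R y x)
    (hRm : MeasurableSet {p : E × E | R p.1 p.2}) {m : ℝ≥0∞} (hm : m ≠ ∞) (ν : Measure E)
    [IsProbabilityMeasure ν] {κ a b : ℝ≥0∞} (hκ : ∀ x, ν {y | R x y} ≤ κ)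
    (hmκ : 2 * m * κ ≤ 2⁻¹) {ι : Type} [Fintype ι] {Φ : (ι → E) → ℝ} (hΦ : Measurable Φ)
    (hat : a ≠ ∞) (ha : ∫⁻ X, ‖Φ X‖ₑ ∂iid ν ι ≤ a)
    (hb : ∀ x j, ∫⁻ X, ‖Φ X‖ₑ * (if R x (X j) then 1 else 0) ∂iid ν ι ≤ b) :
    ‖(grandSum m ν (hardCoreWeight R)).toReal *
        ∫ X, Φ (X ∘ Sum.inl) * Φ (X ∘ Sum.inr) *
          (grandSum m ν (pinned (hardCoreWeight R) X)).toReal ∂iid ν (ι ⊕ ι) -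
      (∫ X, Φ X * (grandSum m ν (pinned (hardCoreWeight R) X)).toReal ∂iid ν ι) ^ 2‖ₑ ≤
    grandSum m ν (hardCoreWeight R) ^ 2 * (2 * (Fintype.card ι : ℝ≥0∞) ^ 2 * a * b) := by
  have hw := isWeight_hardCoreWeight hRm
  set Z := grandSum m ν (hardCoreWeight R)
  have hZt : Z ≠ ∞ := grandSum_hardCoreWeight_ne_top R hm ν
  have hgt : ∀ {κ : Type} (X : κ → E), grandSum m ν (pinned (hardCoreWeight R) X) ≠ ∞ :=
    fun X => ne_top_of_le_ne_top hZt (grandSum_pinned_hardCoreWeight_le R m ν X)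
  have hg1 := measurable_grandSum_pinned (m := m) (ν := ν) hw ι
  have hg2 := measurable_grandSum_pinned (m := m) (ν := ν) hw (ι ⊕ ι)
  have hΦi := ne_top_of_le_ne_top hat ha
  have hi1 := integrable_mul_toReal (P := iid ν ι) hg1 hZt
    (grandSum_pinned_hardCoreWeight_le R m ν) hΦ hΦi
  have hi2 := integrable_mul_toReal (P := iid ν (ι ⊕ ι)) hg2 hZt
    (grandSum_pinned_hardCoreWeight_le R m ν)
    (Ψ := fun X => Φ (X ∘ Sum.inl) * Φ (X ∘ Sum.inr)) (by fun_prop)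
    (by rw [lintegral_enorm_tensor ν hΦ hΦ]; exact ENNReal.mul_ne_top hΦi hΦi)
  have hi2' : Integrable (fun p : (ι → E) × (ι → E) => Φ p.1 * Φ p.2 *
      (grandSum m ν (pinned (hardCoreWeight R) (Sum.elim p.1 p.2))).toReal)
      ((iid ν ι).prod (iid ν ι)) :=
    ((measurePreserving_sumPiEquivProdPi (fun _ : ι ⊕ ι => ν)).symm.integrable_comp_emb
      (MeasurableEquiv.measurableEmbedding _)).2 hi2
  rw [integral_iid_sum, sq, ← integral_prod_mul, ← integral_const_mul, ← integral_sub]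
  rotate_left
  · exact hi2'.const_mul _
  · exact hi1.mul_prod hi1
  refine (enorm_integral_le_lintegral_enorm _).trans ?_
  calc _ ≤ ∫⁻ p, Z ^ 2 * (‖Φ p.1‖ₑ * ‖Φ p.2‖ₑ * correlationBound R ν m p.1 p.2)
        ∂(iid ν ι).prod (iid ν ι) := by
        refine lintegral_mono fun p => ?_
        have e : ∀ z g g1 g2 x y : ℝ, z * (x * y * g) - x * g1 * (y * g2) =
            x * y * (z * g - g1 * g2) := by intros; ring
        simp only [Sum.elim_comp_inl, Sum.elim_comp_inr]
        rw [e, enorm_mul, enorm_mul, mul_left_comm, ← ENNReal.toReal_mul, ← ENNReal.toReal_mul]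
        refine mul_le_mul_right ?_ _
        refine enorm_toReal_sub_le (ENNReal.mul_ne_top hZt (hgt _))
          (ENNReal.mul_ne_top (hgt _) (hgt _)) ?_ ?_
        · rw [sq]
          exact joint_le_split_add hR hRm m ν p.1 p.2
        · rw [sq]
          exact split_le_joint_add hR hRm m ν p.1 p.2
    _ = Z ^ 2 * ∫⁻ X, ∫⁻ X', ‖Φ X‖ₑ * ‖Φ X'‖ₑ * correlationBound R ν m X X'
          ∂iid ν ι ∂iid ν ι := by
        have hM : Measurable fun p : (ι → E) × (ι → E) =>
            ‖Φ p.1‖ₑ * ‖Φ p.2‖ₑ * correlationBound R ν m p.1 p.2 :=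
          (by fun_prop : Measurable fun p : (ι → E) × (ι → E) => ‖Φ p.1‖ₑ * ‖Φ p.2‖ₑ).mul
            (measurable_correlationBound hRm ν m ι ι)
        rw [lintegral_const_mul _ hM, lintegral_prod _ hM.aemeasurable]
    _ ≤ _ := mul_le_mul_right
        (lintegral_correlationBound_le hRm ν hκ hmκ hΦ.enorm ha hb) _

end Variance

section VarianceBound

variable {E : Type*} [MeasurableSpace E]

lemma lintegral_overlap_le {w : ∀ ι : Type, (ι → E) → ℝ≥0∞} (hw : IsWeight w) (m : ℝ≥0∞)
    (ν : Measure E) [SigmaFinite ν] {ι : Type} [Fintype ι] {c : ℝ≥0∞}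
    (hg : ∀ {κ : Type} (X : κ → E), grandSum m ν (pinned w X) ≤ c)
    {Φ : (ι → E) → ℝ} (hΦ : Measurable Φ) {B : ℕ → ℝ≥0∞}
    (hB : ∀ t ∈ overlapTypes ι, ∫⁻ X, ‖Φ (X ∘ Sum.inl) * Φ (X ∘ glueIdx t)‖ₑ
      ∂iid ν (ι ⊕ {i // t i = none}) ≤ B (Fintype.card {i // t i ≠ none})) :
    ∫⁻ ω, ‖tupleSum Φ ω ^ 2 -
        tupleSum (fun X : ι ⊕ ι → E => Φ (X ∘ Sum.inl) * Φ (X ∘ Sum.inr)) ω‖ₑ ∂gibbs m ν w ≤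
      c * ∑ t ∈ overlapTypes ι, m ^ Fintype.card (ι ⊕ {i // t i = none}) *
        B (Fintype.card {i // t i ≠ none}) := by
  have hm : ∀ t : ι → Option ι, Measurable fun X : ι ⊕ {i // t i = none} → E =>
      ‖Φ (X ∘ Sum.inl) * Φ (X ∘ glueIdx t)‖ₑ := fun t =>
    ((hΦ.comp (by fun_prop : Measurable fun X : ι ⊕ {i // t i = none} → E => X ∘ Sum.inl)).mul
      (hΦ.comp (by fun_prop : Measurable fun X : ι ⊕ {i // t i = none} → E =>
        X ∘ glueIdx t))).enorm
  refine (lintegral_mono (enorm_tupleSum_sq_sub_le Φ)).trans ?_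
  rw [lintegral_finsetSum _ fun t _ => measurable_tupleSum (hm t), Finset.mul_sum]
  refine Finset.sum_le_sum fun t ht => ?_
  rw [lintegral_tupleSum hw (hm t), mul_left_comm]
  refine mul_le_mul_right ?_ _
  calc _ ≤ ∫⁻ X, ‖Φ (X ∘ Sum.inl) * Φ (X ∘ glueIdx t)‖ₑ * c ∂iid ν (ι ⊕ {i // t i = none}) :=
        lintegral_mono fun X => mul_le_mul_right (hg X) _
    _ = (∫⁻ X, ‖Φ (X ∘ Sum.inl) * Φ (X ∘ glueIdx t)‖ₑ ∂iid ν (ι ⊕ {i // t i = none})) * c :=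
        lintegral_mul_const _ (hm t)
    _ ≤ c * B _ := by
        rw [mul_comm]
        exact mul_le_mul_right (hB t ht) _

/-- The variance of a sum over tuples of distinct particles of a dilute hard-core gas. -/
theorem variance_tupleSum_le {R : E → E → Prop} (hR : ∀ x y, R x y → R y x)
    (hRm : MeasurableSet {p : E × E | R p.1 p.2}) {μ : ℝ} (hμ : 0 < μ) (ν : Measure E)
    [IsProbabilityMeasure ν] {κ a b : ℝ≥0∞} (hκ : ∀ x, ν {y | R x y} ≤ κ)
    (hμκ : 2 * ENNReal.ofReal μ * κ ≤ 2⁻¹) {ι : Type} [Fintype ι] {Φ : (ι → E) → ℝ}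
    (hΦ : Measurable Φ) (hat : a ≠ ∞) (ha : ∫⁻ X, ‖Φ X‖ₑ ∂iid ν ι ≤ a)
    (hb : ∀ x j, ∫⁻ X, ‖Φ X‖ₑ * (if R x (X j) then 1 else 0) ∂iid ν ι ≤ b)
    {B : ℕ → ℝ≥0∞} (hBt : ∀ l, B l ≠ ∞)
    (hB : ∀ t ∈ overlapTypes ι, ∫⁻ X, ‖Φ (X ∘ Sum.inl) * Φ (X ∘ glueIdx t)‖ₑ
      ∂iid ν (ι ⊕ {i // t i = none}) ≤ B (Fintype.card {i // t i ≠ none})) {e : ℝ}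
    (he : e = (grandSum (ENNReal.ofReal μ) ν (hardCoreWeight R)).toReal⁻¹ * ∫ X, Φ X *
      (grandSum (ENNReal.ofReal μ) ν (pinned (hardCoreWeight R) X)).toReal ∂iid ν ι) :
    ∫⁻ ω, ENNReal.ofReal (((μ ^ Fintype.card ι)⁻¹ * tupleSum Φ ω - e) ^ 2)
        ∂gibbs (ENNReal.ofReal μ) ν (hardCoreWeight R) ≤
      grandSum (ENNReal.ofReal μ) ν (hardCoreWeight R) *
        (∑ t ∈ overlapTypes ι, (ENNReal.ofReal μ ^ Fintype.card {i // t i ≠ none})⁻¹ *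
            B (Fintype.card {i // t i ≠ none}) +
          2 * (Fintype.card ι : ℝ≥0∞) ^ 2 * a * b) := by
  have hw := isWeight_hardCoreWeight hRm
  set m := ENNReal.ofReal μ with hm
  have hmt : m ≠ ∞ := ENNReal.ofReal_ne_top
  have hmR : m.toReal = μ := ENNReal.toReal_ofReal hμ.le
  set Z := grandSum m ν (hardCoreWeight R)
  set P := gibbs m ν (hardCoreWeight R)
  have hZt : Z ≠ ∞ := grandSum_hardCoreWeight_ne_top R hmt ν
  have hZ0 : Z ≠ 0 := (zero_lt_one.trans_le (one_le_grandSum_hardCoreWeight R m ν)).ne'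
  have hPuniv : P Set.univ = Z := gibbs_univ hw
  have : IsFiniteMeasure P := ⟨by rw [hPuniv]; exact hZt.lt_top⟩
  have hZpos : 0 < Z.toReal := ENNReal.toReal_pos hZ0 hZt
  have hΦi := ne_top_of_le_ne_top hat ha
  set Ψ : (ι ⊕ ι → E) → ℝ := fun X => Φ (X ∘ Sum.inl) * Φ (X ∘ Sum.inr) with hΨ
  have hΨm : Measurable Ψ := by fun_prop
  have hΨi : ∫⁻ X, ‖Ψ X‖ₑ ∂iid ν (ι ⊕ ι) ≠ ∞ := by
    rw [hΨ, lintegral_enorm_tensor ν hΦ hΦ]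
    exact ENNReal.mul_ne_top hΦi hΦi
  have hg : ∀ {κ : Type} (X : κ → E), grandSum m ν (pinned (hardCoreWeight R) X) ≤ Z :=
    grandSum_pinned_hardCoreWeight_le R m ν
  have hF := integrable_tupleSum hw hmt hZt hg hΦ hΦi
  have hT := integrable_tupleSum hw hmt hZt hg hΨm hΨi
  have hFe := integral_tupleSum hw hmt hZt hg hΦ hΦi
  have hTe := integral_tupleSum hw hmt hZt hg hΨm hΨi
  rw [hmR] at hFe hTe
  rw [Fintype.card_sum] at hTe
  have hD := lintegral_overlap_le hw m ν hg hΦ hB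
  have hDi : Integrable (fun ω => tupleSum Φ ω ^ 2 - tupleSum Ψ ω) P := by
    refine ⟨(((measurable_tupleSum hΦ).pow_const 2).sub
      (measurable_tupleSum hΨm)).aestronglyMeasurable, lt_of_le_of_lt hD ?_⟩
    refine ENNReal.mul_lt_top hZt.lt_top (ENNReal.sum_lt_top.2 fun t _ => ?_)
    exact ENNReal.mul_lt_top (ENNReal.pow_lt_top hmt.lt_top) (hBt _).lt_top
  set D := ∫ ω, (tupleSum Φ ω ^ 2 - tupleSum Ψ ω) ∂P with hDdef
  set I := ∫ X, Ψ X * (grandSum m ν (pinned (hardCoreWeight R) X)).toReal ∂iid ν (ι ⊕ ι)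
  set J := ∫ X, Φ X * (grandSum m ν (pinned (hardCoreWeight R) X)).toReal ∂iid ν ι
  set q := (μ ^ Fintype.card ι)⁻¹
  have hqμ : q * μ ^ Fintype.card ι = 1 := inv_mul_cancel₀ (by positivity)
  have hF2 : Integrable (fun ω => tupleSum Φ ω ^ 2) P := by
    refine (hDi.add hT).congr (Filter.Eventually.of_forall fun ω => ?_)
    simp
  have hF2e : ∫ ω, tupleSum Φ ω ^ 2 ∂P = D + μ ^ (Fintype.card ι + Fintype.card ι) * I := by
    rw [hDdef, ← hTe, ← integral_add hDi hT]
    simp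
  have hexp : ∀ ω, (q * tupleSum Φ ω - e) ^ 2 =
      q ^ 2 * tupleSum Φ ω ^ 2 - 2 * q * e * tupleSum Φ ω + e ^ 2 := fun ω => by ring
  have h1 : Integrable (fun ω => q ^ 2 * tupleSum Φ ω ^ 2) P := hF2.const_mul _
  have h2 : Integrable (fun ω => 2 * q * e * tupleSum Φ ω) P := hF.const_mul _
  have h12 : Integrable (fun ω => q ^ 2 * tupleSum Φ ω ^ 2 - 2 * q * e * tupleSum Φ ω) P :=
    h1.sub h2
  have hvar : ∫ ω, (q * tupleSum Φ ω - e) ^ 2 ∂P =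
      q ^ 2 * D + Z.toReal⁻¹ * (Z.toReal * I - J ^ 2) := by
    simp_rw [hexp]
    rw [integral_add h12 (integrable_const _), integral_sub h1 h2, integral_const_mul,
      integral_const_mul, hF2e, hFe, integral_const, measureReal_def, hPuniv, smul_eq_mul, he,
      pow_add]
    have e1 : q ^ 2 * (D + μ ^ Fintype.card ι * μ ^ Fintype.card ι * I) =
        q ^ 2 * D + (q * μ ^ Fintype.card ι) ^ 2 * I := by ring
    have e2 : 2 * q * (Z.toReal⁻¹ * J) * (μ ^ Fintype.card ι * J) =
        2 * (q * μ ^ Fintype.card ι) * (Z.toReal⁻¹ * J ^ 2) := by ring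
    rw [e1, e2, hqμ]
    field_simp
    ring
  have hint : Integrable (fun ω => (q * tupleSum Φ ω - e) ^ 2) P := by
    simp_rw [hexp]
    exact h12.add (integrable_const _)
  rw [← ofReal_integral_eq_lintegral_ofReal hint (Filter.Eventually.of_forall fun ω => sq_nonneg _),
    hvar]
  refine (ENNReal.ofReal_add_le).trans ?_
  rw [mul_add]
  refine add_le_add ?_ ?_
  · rw [ENNReal.ofReal_mul (by positivity)]
    calc ENNReal.ofReal (q ^ 2) * ENNReal.ofReal D
        ≤ ENNReal.ofReal (q ^ 2) * (Z * ∑ t ∈ overlapTypes ι,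
            m ^ Fintype.card (ι ⊕ {i // t i = none}) * B (Fintype.card {i // t i ≠ none})) := by
          refine mul_le_mul_right ?_ _
          refine ((ENNReal.ofReal_le_ofReal (le_abs_self D)).trans ?_).trans hD
          rw [← Real.norm_eq_abs, ofReal_norm]
          exact enorm_integral_le_lintegral_enorm _
      _ ≤ _ := by
          rw [mul_left_comm, Finset.mul_sum]
          refine mul_le_mul_right (Finset.sum_le_sum fun t _ => ?_) _
          rw [← mul_assoc]
          refine mul_le_mul_left (le_of_eq ?_) _
          have hcard : Fintype.card {i // t i = none} + Fintype.card {i // t i ≠ none} =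
              Fintype.card ι := by
            rw [← Fintype.card_sum]
            exact Fintype.card_congr (Equiv.sumCompl fun i => t i = none)
          have hreal : q ^ 2 * μ ^ Fintype.card (ι ⊕ {i // t i = none}) =
              (μ ^ Fintype.card {i // t i ≠ none})⁻¹ := by
            refine eq_inv_of_mul_eq_one_left ?_
            rw [Fintype.card_sum, mul_assoc, ← pow_add, add_assoc, hcard, pow_add]
            calc _ = (q * μ ^ Fintype.card ι) ^ 2 := by ring
              _ = 1 := by rw [hqμ, one_pow]
          rw [hm, ← ENNReal.ofReal_pow hμ.le, ← ENNReal.ofReal_mul (by positivity), hreal,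
            ENNReal.ofReal_inv_of_pos (by positivity), ENNReal.ofReal_pow hμ.le]
  · have hC := enorm_covariance_le hR hRm hmt ν hκ hμκ hΦ hat ha hb
    rw [ENNReal.ofReal_mul (by positivity), ENNReal.ofReal_inv_of_pos hZpos,
      ENNReal.ofReal_toReal hZt]
    calc Z⁻¹ * ENNReal.ofReal (Z.toReal * I - J ^ 2)
        ≤ Z⁻¹ * (Z ^ 2 * (2 * (Fintype.card ι : ℝ≥0∞) ^ 2 * a * b)) := by
          refine mul_le_mul_right (le_trans ?_ hC) _
          rw [← ofReal_norm]
          exact ENNReal.ofReal_le_ofReal (le_abs_self _)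
      _ = _ := by
          rw [sq, mul_assoc Z Z, ← mul_assoc, ENNReal.inv_mul_cancel hZ0 hZt, one_mul]

end VarianceBound

section ProductDensity

variable {E : Type*} [MeasurableSpace E]

lemma lintegral_pi_fin_succ_last {n : ℕ} (μ : Fin (n + 1) → Measure E) (hμ : ∀ i, SigmaFinite (μ i))
    {F : (Fin (n + 1) → E) → ℝ≥0∞} (hF : Measurable F) :
    ∫⁻ Z, F Z ∂Measure.pi μ =
      ∫⁻ z, ∫⁻ Y, F ((Fin.last n).insertNth z Y) ∂Measure.pi (fun j => μ j.castSucc)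
        ∂μ (Fin.last n) := by
  have h := (measurePreserving_piFinSuccAbove μ (Fin.last n)).symm
  have hF' := hF.comp (MeasurableEquiv.piFinSuccAbove (fun _ : Fin (n + 1) => E)
    (Fin.last n)).symm.measurable
  rw [← h.map_eq, lintegral_map_equiv]
  refine (lintegral_prod _ hF'.aemeasurable).trans ?_
  simp only [Fin.succAbove_last]
  rfl

lemma lintegral_pi_fin_prod {n : ℕ} (μ : Fin n → Measure E) (hμ : ∀ i, SigmaFinite (μ i))
    {f : Fin n → E → ℝ≥0∞} (hf : ∀ i, Measurable (f i)) :
    ∫⁻ Z, ∏ i, f i (Z i) ∂Measure.pi μ = ∏ i, ∫⁻ z, f i z ∂μ i := by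
  induction n with
  | zero => simp
  | succ n ih =>
    rw [lintegral_pi_fin_succ_last μ hμ (by fun_prop), Fin.prod_univ_castSucc,
      ← ih (fun j => μ j.castSucc) (fun j => hμ _) (fun j => hf j.castSucc), mul_comm,
      ← lintegral_mul_const _ (hf _)]
    refine lintegral_congr fun z => ?_
    rw [← lintegral_const_mul _ (by fun_prop)]
    refine lintegral_congr fun Y => ?_
    rw [Fin.prod_univ_castSucc, mul_comm]
    simp only [Fin.insertNth_apply_same, ← Fin.succAbove_last_apply,
      Fin.insertNth_apply_succAbove]

lemma pi_fin_withDensity {n : ℕ} (μ : Fin n → Measure E) (hμ : ∀ i, SigmaFinite (μ i))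
    {f : Fin n → E → ℝ≥0∞} (hf : ∀ i, Measurable (f i))
    (hf' : ∀ i, SigmaFinite ((μ i).withDensity (f i))) :
    Measure.pi (fun i => (μ i).withDensity (f i)) =
      (Measure.pi μ).withDensity fun Z => ∏ i, f i (Z i) := by
  refine Measure.pi_eq fun s hs => ?_
  rw [withDensity_apply _ (MeasurableSet.univ_pi hs), Measure.restrict_pi_pi,
    lintegral_pi_fin_prod _ (fun i => inferInstance) hf]
  exact Finset.prod_congr rfl fun i _ => (withDensity_apply _ (hs i)).symm

end ProductDensity

section Counting

lemma sum_option_inv_card_pow (ι : Type) [Fintype ι] [Nonempty ι] :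
    ∑ t : ι → Option ι, ((Fintype.card ι : ℝ)⁻¹) ^ Fintype.card {i // t i ≠ none} =
      2 ^ Fintype.card ι := by
  have h : ∀ t : ι → Option ι, ((Fintype.card ι : ℝ)⁻¹) ^ Fintype.card {i // t i ≠ none} =
      ∏ i, if t i = none then 1 else (Fintype.card ι : ℝ)⁻¹ := fun t => by
    rw [Finset.prod_ite, Finset.prod_const_one, one_mul, Finset.prod_const,
      Fintype.card_subtype]
  rw [Finset.sum_congr rfl fun t _ => h t]
  have := Finset.prod_univ_sum (fun _ : ι => (Finset.univ : Finset (Option ι)))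
    (fun _ o => if o = none then (1 : ℝ) else (Fintype.card ι : ℝ)⁻¹)
  rw [Fintype.piFinset_univ] at this
  rw [← this]
  have hc : (Fintype.card ι : ℝ) ≠ 0 := by simp
  simp [Fintype.sum_option, hc]
  norm_num

end Counting

section Maxwell

instance isProbabilityMeasure_volume_addCircle_one :
    IsProbabilityMeasure (volume : Measure (AddCircle (1 : ℝ))) :=
  ⟨by rw [AddCircle.measure_univ]; simp⟩

lemma maxwellian_pos (d : ℕ) (v : EuclideanSpace ℝ (Fin d)) : 0 < maxwellian d v := by
  unfold maxwellian; positivity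

lemma measurable_maxwellian (d : ℕ) : Measurable (maxwellian d) := by
  unfold maxwellian; fun_prop

lemma integral_maxwellian (d : ℕ) : ∫ v, maxwellian d v = 1 := by
  unfold maxwellian
  rw [integral_const_mul]
  have := GaussianFourier.integral_rexp_neg_mul_sq_norm (V := EuclideanSpace ℝ (Fin d))
    (b := 1 / 2) (by norm_num)
  have e : ∀ v : EuclideanSpace ℝ (Fin d), -‖v‖ ^ 2 / 2 = -(1 / 2) * ‖v‖ ^ 2 := fun v => by ring
  simp only [e]
  rw [this, finrank_euclideanSpace_fin, show π / (1 / 2) = 2 * π by ring,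
    ← rpow_add (by positivity)]
  ring_nf
  simp

/-- The law of a single ideal-gas particle: uniform position and Maxwellian velocity. -/
def phaseMeasure (d : ℕ) : Measure (Phase d) :=
  volume.withDensity fun z => ENNReal.ofReal (maxwellian d z.2)

lemma lintegral_maxwellian (d : ℕ) : ∫⁻ v, ENNReal.ofReal (maxwellian d v) = 1 := by
  rw [← ofReal_integral_eq_lintegral_ofReal, integral_maxwellian, ENNReal.ofReal_one]
  · by_contra h
    simpa [integral_undef h] using integral_maxwellian d
  · exact ae_of_all _ fun v => (maxwellian_pos d v).le

lemma measurable_ofReal_maxwellian_snd (d : ℕ) :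
    Measurable fun z : Phase d => ENNReal.ofReal (maxwellian d z.2) :=
  ((measurable_maxwellian d).comp measurable_snd).ennreal_ofReal

lemma phaseMeasure_eq_prod (d : ℕ) : phaseMeasure d =
    (volume : Measure (Torus d)).prod
      (volume.withDensity fun v => ENNReal.ofReal (maxwellian d v)) :=
  (prod_withDensity_right (measurable_maxwellian d).ennreal_ofReal).symm

instance isProbabilityMeasure_withDensity_maxwellian (d : ℕ) :
    IsProbabilityMeasure (volume.withDensity fun v => ENNReal.ofReal (maxwellian d v)) :=
  ⟨by rw [withDensity_apply _ MeasurableSet.univ, setLIntegral_univ, lintegral_maxwellian]⟩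

instance isProbabilityMeasure_phaseMeasure (d : ℕ) : IsProbabilityMeasure (phaseMeasure d) := by
  rw [phaseMeasure_eq_prod]; infer_instance

lemma sigmaFinite_volume_phase (d : ℕ) : SigmaFinite (volume : Measure (Phase d)) :=
  inferInstance

lemma sFinite_volume_pi_phase (d n : ℕ) :
    SFinite (volume : Measure (Fin n → Phase d)) :=
  @instSFiniteOfSigmaFinite _ _ _ <|
    @Measure.pi.sigmaFinite _ _ _ _ _ fun _ => sigmaFinite_volume_phase d

lemma measurable_lintegral_insertNth_last {d n : ℕ} {F : (Fin (n + 1) → Phase d) → ℝ≥0∞}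
    (hF : Measurable F) : Measurable fun z : Phase d => ∫⁻ Y : Fin n → Phase d,
      F ((Fin.last n).insertNth z Y) := by
  refine @Measurable.lintegral_prod_right _ _ _ _ _
    (sFinite_volume_pi_phase d n) _ (hF.comp ?_)
  exact (MeasurableEquiv.piFinSuccAbove (fun _ : Fin (n + 1) => Phase d)
    (Fin.last n)).symm.measurable

lemma iid_phaseMeasure (d n : ℕ) : iid (phaseMeasure d) (Fin n) =
    volume.withDensity fun Z => ∏ i, ENNReal.ofReal (maxwellian d (Z i).2) := by
  exact pi_fin_withDensity (fun _ : Fin n => (volume : Measure (Phase d)))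
    (fun _ => sigmaFinite_volume_phase d) (fun _ => measurable_ofReal_maxwellian_snd d)
    fun _ => inferInstanceAs (SigmaFinite (phaseMeasure d))

lemma measurable_prod_maxwellian (d n : ℕ) : Measurable fun Z : Fin n → Phase d =>
    ∏ i, ENNReal.ofReal (maxwellian d (Z i).2) :=
  Finset.measurable_prod _ fun i _ =>
    (measurable_ofReal_maxwellian_snd d).comp (measurable_pi_apply i)

lemma lintegral_iid_phaseMeasure (d n : ℕ) {F : (Fin n → Phase d) → ℝ≥0∞} (hF : Measurable F) :
    ∫⁻ Z, F Z ∂iid (phaseMeasure d) (Fin n) =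
      ∫⁻ Z, (∏ i, ENNReal.ofReal (maxwellian d (Z i).2)) * F Z := by
  rw [iid_phaseMeasure, lintegral_withDensity_eq_lintegral_mul _
    (measurable_prod_maxwellian d n) hF]
  rfl

lemma integral_iid_phaseMeasure (d n : ℕ) (F : (Fin n → Phase d) → ℝ) :
    ∫ Z, F Z ∂iid (phaseMeasure d) (Fin n) =
      ∫ Z : Fin n → Phase d, (∏ i, maxwellian d (Z i).2) * F Z := by
  rw [iid_phaseMeasure, integral_withDensity_eq_integral_toReal_smul
    (measurable_prod_maxwellian d n)
    (ae_of_all _ fun Z => ENNReal.prod_lt_top fun i _ => ENNReal.ofReal_lt_top)]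
  refine integral_congr_ae (ae_of_all _ fun Z => ?_)
  simp [ENNReal.toReal_prod, ENNReal.toReal_ofReal (maxwellian_pos d _).le]

instance sigmaFinite_lastFixed_factor (d N : ℕ) (x : Torus d) (i : Fin N) :
    SigmaFinite (if (i : ℕ) = N - 1 then
      (Measure.dirac x).prod (volume : Measure (EuclideanSpace ℝ (Fin d)))
    else (volume : Measure (Phase d))) := by
  split_ifs <;> infer_instance

lemma lintegral_lastFixed (d n : ℕ) (x : Torus d) {F : (Fin (n + 1) → Phase d) → ℝ≥0∞}
    (hF : Measurable F) :
    ∫⁻ Z, F Z ∂lastFixed d (n + 1) x = ∫⁻ v, ∫⁻ Y, F ((Fin.last n).insertNth (x, v) Y) := by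
  have : ∀ j : Fin n, (j : ℕ) ≠ n := fun j => j.isLt.ne
  have hm := measurable_lintegral_insertNth_last hF
  rw [lastFixed, lintegral_pi_fin_succ_last _ (sigmaFinite_lastFixed_factor d _ x) hF]
  simp only [Fin.val_last, add_tsub_cancel_right, if_true, Fin.val_castSucc, this, if_false]
  refine (lintegral_prod _ hm.aemeasurable).trans ?_
  rw [lintegral_dirac' _ hm.lintegral_prod_right]

lemma lintegral_iid_eq_lastFixed (d n : ℕ) {F : (Fin (n + 1) → Phase d) → ℝ≥0∞}
    (hF : Measurable F) {h : Torus d → ℝ≥0∞} (hh : Measurable h) :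
    ∫⁻ Z, h (Z (Fin.last n)).1 * F Z ∂iid (phaseMeasure d) (Fin (n + 1)) =
      ∫⁻ x, h x * ∫⁻ Z, (∏ i, ENNReal.ofReal (maxwellian d (Z i).2)) * F Z
        ∂lastFixed d (n + 1) x := by
  have hF' := (measurable_prod_maxwellian d (n + 1)).mul hF
  have hm : ∀ z : Phase d, Measurable fun Y : Fin n → Phase d =>
      (Fin.last n).insertNth (α := fun _ => Phase d) z Y := fun z =>
    (MeasurableEquiv.piFinSuccAbove (fun _ : Fin (n + 1) => Phase d)
      (Fin.last n)).symm.measurable.comp (measurable_const.prodMk measurable_id)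
  have hG : Measurable fun Z : Fin (n + 1) → Phase d =>
      (∏ i, ENNReal.ofReal (maxwellian d (Z i).2)) * (h (Z (Fin.last n)).1 * F Z) := by
    have := measurable_prod_maxwellian d (n + 1)
    fun_prop
  rw [lintegral_iid_phaseMeasure _ _ (by fun_prop), volume_pi,
    lintegral_pi_fin_succ_last _ (fun _ => sigmaFinite_volume_phase d) hG]
  refine (lintegral_prod _ (measurable_lintegral_insertNth_last hG).aemeasurable).trans ?_
  refine lintegral_congr fun x => ?_
  refine Eq.trans ?_ (congrArg (h x * ·) (lintegral_lastFixed d n x hF').symm)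
  simp only [Pi.mul_apply]
  rw [← lintegral_const_mul]
  · refine lintegral_congr fun v => ?_
    rw [← lintegral_const_mul]
    · refine lintegral_congr fun Y => ?_
      simp only [Fin.insertNth_apply_same]
      ring
    · exact hF'.comp (hm _)
  · exact (measurable_lintegral_insertNth_last hF').comp measurable_prodMk_left

end Maxwell

section Overlap

variable {d : ℕ}

/-- Two particles overlap if the distance of their positions is at most `ε`. -/
def Overlap (ε : ℝ) (z w : Phase d) : Prop := torusDist z.1 w.1 ≤ ε

lemma torusDist_comm (x y : Torus d) : torusDist x y = torusDist y x := by
  simp only [torusDist, dist_comm]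

lemma Overlap.symm {ε : ℝ} {z w : Phase d} (h : Overlap ε z w) : Overlap ε w z := by
  rwa [Overlap, torusDist_comm]

lemma measurableSet_overlap (ε : ℝ) :
    MeasurableSet {p : Phase d × Phase d | Overlap ε p.1 p.2} := by
  have : Measurable fun p : Phase d × Phase d => torusDist p.1.1 p.2.1 := by
    unfold torusDist; fun_prop
  exact measurableSet_le this measurable_const

lemma hardCore_iff_indep {ε : ℝ} {N : ℕ} (Z : Fin N → Phase d) :
    HardCore d ε Z ↔ Indep (Overlap ε) Z := by
  simp [HardCore, Indep, Overlap]

lemma volume_torusDist_le {ε : ℝ} (hε : 0 ≤ ε) (x : Torus d) :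
    volume {y : Torus d | torusDist x y ≤ ε} ≤ ENNReal.ofReal ((2 * ε) ^ d) := by
  have hsub : {y : Torus d | torusDist x y ≤ ε} ⊆
      Set.pi Set.univ fun i => Metric.closedBall (x i) ε := fun y hy i _ => by
    rw [Metric.mem_closedBall, dist_comm]
    refine le_trans ?_ hy
    refine Real.le_sqrt_of_sq_le ?_
    exact Finset.single_le_sum (f := fun i => dist (x i) (y i) ^ 2)
      (fun i _ => sq_nonneg _) (Finset.mem_univ i)
  refine (measure_mono hsub).trans ?_
  rw [volume_pi_pi, ENNReal.ofReal_pow (by positivity)]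
  refine (Finset.prod_le_prod' fun i _ => ?_).trans_eq (Fin.prod_const d _)
  rw [AddCircle.volume_closedBall]
  exact ENNReal.ofReal_le_ofReal (min_le_right _ _)

lemma phaseMeasure_overlap_le {ε : ℝ} (hε : 0 ≤ ε) (z : Phase d) :
    phaseMeasure d {w | Overlap ε z w} ≤ ENNReal.ofReal ((2 * ε) ^ d) := by
  have : {w : Phase d | Overlap ε z w} = {y : Torus d | torusDist z.1 y ≤ ε} ×ˢ Set.univ := by
    ext; simp [Overlap]
  rw [phaseMeasure_eq_prod, this, Measure.prod_prod, measure_univ, mul_one]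
  exact volume_torusDist_le hε _

lemma lintegral_iid_le_of_lastFixed {n : ℕ} {F : (Fin (n + 1) → Phase d) → ℝ≥0∞}
    (hF : Measurable F) {h : Torus d → ℝ≥0∞} (hh : Measurable h) {c : ℝ≥0∞}
    (hc : ∀ x, ∫⁻ Z, (∏ i, ENNReal.ofReal (maxwellian d (Z i).2)) * F Z
      ∂lastFixed d (n + 1) x ≤ c) :
    ∫⁻ Z, h (Z (Fin.last n)).1 * F Z ∂iid (phaseMeasure d) (Fin (n + 1)) ≤
      (∫⁻ x, h x) * c := by
  rw [lintegral_iid_eq_lastFixed d n hF hh, ← lintegral_mul_const _ hh]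
  exact lintegral_mono fun x => mul_le_mul_right (hc x) _

lemma lintegral_iid_le_of_lastFixed_one {N : ℕ} (hN : 1 ≤ N) {F : (Fin N → Phase d) → ℝ≥0∞}
    (hF : Measurable F) {c : ℝ≥0∞}
    (hc : ∀ x, ∫⁻ Z, (∏ i, ENNReal.ofReal (maxwellian d (Z i).2)) * F Z
      ∂lastFixed d N x ≤ c) :
    ∫⁻ Z, F Z ∂iid (phaseMeasure d) (Fin N) ≤ c := by
  obtain ⟨n, rfl⟩ : ∃ n, N = n + 1 := ⟨N - 1, by omega⟩
  simpa using lintegral_iid_le_of_lastFixed hF (measurable_const (a := (1 : ℝ≥0∞))) hc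

lemma lintegral_iid_overlap_le {ε : ℝ} (hε : 0 ≤ ε) {N : ℕ} {F : (Fin N → Phase d) → ℝ≥0∞}
    (hF : Measurable F) (hσ : ∀ (σ : Equiv.Perm (Fin N)) Z, F (Z ∘ σ) = F Z) {c : ℝ≥0∞}
    (hc : ∀ x, ∫⁻ Z, (∏ i, ENNReal.ofReal (maxwellian d (Z i).2)) * F Z
      ∂lastFixed d N x ≤ c) (z : Phase d) (j : Fin N) :
    ∫⁻ Z, F Z * (if Overlap ε z (Z j) then 1 else 0) ∂iid (phaseMeasure d) (Fin N) ≤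
      ENNReal.ofReal ((2 * ε) ^ d) * c := by
  obtain ⟨n, rfl⟩ : ∃ n, N = n + 1 := ⟨N - 1, by have := j.isLt; omega⟩
  have hS : MeasurableSet {y : Torus d | torusDist z.1 y ≤ ε} :=
    measurableSet_le (by unfold torusDist; fun_prop) measurable_const
  have hh : Measurable fun y : Torus d => if torusDist z.1 y ≤ ε then (1 : ℝ≥0∞) else 0 :=
    Measurable.ite hS measurable_const measurable_const
  have hmass : ∫⁻ y : Torus d, (if torusDist z.1 y ≤ ε then (1 : ℝ≥0∞) else 0) ≤
      ENNReal.ofReal ((2 * ε) ^ d) := by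
    refine Eq.trans_le ?_ (volume_torusDist_le hε z.1)
    rw [← lintegral_indicator_one hS]
    exact lintegral_congr fun y => by simp [Set.indicator_apply]
  have := (lintegral_iid_le_of_lastFixed hF hh hc).trans (mul_le_mul_left hmass c)
  rw [← lintegral_iid_comp_equiv (phaseMeasure d) (Equiv.swap j (Fin.last n))] at this
  simp only [hσ, Function.comp_apply, Equiv.swap_apply_right] at this
  refine Eq.trans_le (lintegral_congr fun Z => ?_) this
  by_cases hZ : torusDist z.1 (Z j).1 ≤ ε <;> simp [Overlap, hZ]

lemma ofReal_abs_mul_prod_maxwellian {N : ℕ} (a : ℝ) (Z : Fin N → Phase d) :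
    ENNReal.ofReal (|a| * ∏ i, maxwellian d (Z i).2) =
      (∏ i, ENNReal.ofReal (maxwellian d (Z i).2)) * ‖a‖ₑ := by
  rw [mul_comm, ENNReal.ofReal_mul (Finset.prod_nonneg fun i _ => (maxwellian_pos d _).le),
    ENNReal.ofReal_prod_of_nonneg fun i _ => (maxwellian_pos d _).le, ← Real.norm_eq_abs,
    ofReal_norm]

end Overlap

section CrossTerms

lemma comp_eq_of_range_subset {E : Type*} {N : ℕ} {Φ : (Fin N → E) → ℝ}
    (hσ : ∀ (σ : Equiv.Perm (Fin N)) Z, Φ (Z ∘ σ) = Φ Z) {κ : Type*} {f g : Fin N → κ}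
    (hf : Function.Injective f) (hfg : ∀ i, ∃ j, f i = g j) (Z : κ → E) :
    Φ (Z ∘ f) = Φ (Z ∘ g) := by
  choose σ hσ' using hfg
  have hi : Function.Injective σ := fun a b h => hf (by rw [hσ', hσ', h])
  rw [← hσ (Equiv.ofBijective σ (Finite.injective_iff_bijective.1 hi)) (Z ∘ g)]
  congr 1
  funext i
  simp [hσ']

lemma card_some_values_eq {N : ℕ} {t : Fin N → Option (Fin N)}
    (ht : Function.Injective (glueIdx t)) :
    Fintype.card {a : Fin N // ∃ i, t i = some a} = Fintype.card {i // t i ≠ none} := by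
  refine (Fintype.card_congr (Equiv.ofBijective
    (fun i : {i // t i ≠ none} =>
      (⟨(t i).get (Option.isSome_iff_ne_none.2 i.2), i, by simp⟩ : {a // ∃ i, t i = some a}))
    ⟨fun i j h => ?_, fun ⟨a, i, h⟩ => ⟨⟨i, by simp [h]⟩, by simp [h]⟩⟩)).symm
  simp only [Subtype.mk.injEq] at h
  refine Subtype.ext (ht ?_)
  rw [glueIdx_of_eq_some (Option.some_get (Option.isSome_iff_ne_none.2 i.2)).symm,
    glueIdx_of_eq_some (Option.some_get (Option.isSome_iff_ne_none.2 j.2)).symm, h]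

lemma exists_equiv_glueIdx {N : ℕ} {t : Fin N → Option (Fin N)}
    (ht : Function.Injective (glueIdx t)) {l : ℕ} (hl : Fintype.card {i // t i ≠ none} = l) :
    ∃ (hlN : l ≤ N) (e : Fin N ⊕ {i // t i = none} ≃ Fin (2 * N - l)),
      (∀ i : Fin N, ∃ j : Fin N, e (Sum.inl i) = Fin.castLE (by omega) j) ∧
      ∀ i : Fin N, ∃ j : Fin N, e (glueIdx t i) =
        ⟨if (j : ℕ) < l then (j : ℕ) else (j : ℕ) + (N - l),
          by have := j.isLt; split <;> omega⟩ := by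
  have hlN : l ≤ N := by
    rw [← hl]; exact (Fintype.card_subtype_le _).trans_eq (Fintype.card_fin N)
  have hcard : Fintype.card {a : Fin N // ∃ i, t i = some a} =
      Fintype.card {a : Fin N // (a : ℕ) < l} := by
    rw [card_some_values_eq ht, hl, Fintype.card_subtype, Fin.card_filter_val_lt]
    omega
  let p : Equiv.Perm (Fin N) := (Fintype.equivOfCardEq hcard).extendSubtype
  have hp : ∀ a, (∃ i, t i = some a) → (p a : ℕ) < l := fun a ha =>
    (Fintype.equivOfCardEq hcard).extendSubtype_mem a ha
  have hnone : Fintype.card {i // t i = none} = N - l := by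
    have := Fintype.card_subtype_compl fun i => t i = none
    have h2 : Fintype.card {i // t i = none} ≤ N :=
      (Fintype.card_subtype_le _).trans_eq (Fintype.card_fin N)
    rw [Fintype.card_fin] at this
    have h3 : Fintype.card {i // ¬ t i = none} = l := by rw [← hl]
    omega
  let u : {i // t i = none} ≃ Fin (N - l) := Fintype.equivFinOfCardEq hnone
  have hN : N + (N - l) = 2 * N - l := by omega
  refine ⟨hlN, ((Equiv.sumCongr p u).trans finSumFinEquiv).trans (finCongr hN),
    fun i => ⟨p i, rfl⟩, fun i => ?_⟩
  rcases h : t i with _ | a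
  · refine ⟨⟨l + u ⟨i, h⟩, by have := (u ⟨i, h⟩).isLt; omega⟩, ?_⟩
    rw [glueIdx_of_eq_none h]
    ext
    simp
    omega
  · refine ⟨p a, ?_⟩
    rw [glueIdx_of_eq_some h]
    ext
    simp [hp a ⟨i, h⟩]

end CrossTerms

section Ensemble

lemma integral_iid_comp_equiv {E : Type*} [MeasurableSpace E] (ν : Measure E) [SigmaFinite ν]
    {ι κ : Type} [Fintype ι] [Fintype κ] (e : ι ≃ κ) (f : (ι → E) → ℝ) :
    ∫ Z, f (Z ∘ e) ∂iid ν κ = ∫ Y, f Y ∂iid ν ι := by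
  have h := measurePreserving_piCongrLeft (fun _ : ι => ν) e.symm
  refine Eq.trans (integral_congr_ae (ae_of_all _ fun Z => congrArg f ?_)) (h.integral_comp' f)
  ext i
  simp [MeasurableEquiv.piCongrLeft, Equiv.piCongrLeft, Equiv.piCongrLeft']

lemma hardCoreWeight_le_one {E : Type*} (R : E → E → Prop) (ι : Type) (Y : ι → E) :
    hardCoreWeight R ι Y ≤ 1 := by
  unfold hardCoreWeight; split_ifs <;> simp

lemma integral_weight_mul_comp_castAdd {E : Type*} [MeasurableSpace E] (ν : Measure E)
    [IsProbabilityMeasure ν] {w : ∀ ι : Type, (ι → E) → ℝ≥0∞} (hw : IsWeight w)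
    (hw1 : ∀ ι Y, w ι Y ≤ 1) {N p : ℕ} {Φ : (Fin N → E) → ℝ} (hΦ : Integrable Φ (iid ν (Fin N))) :
    ∫ Z, (w (Fin (N + p)) Z).toReal * Φ (Z ∘ Fin.castAdd p) ∂iid ν (Fin (N + p)) =
      ∫ X, Φ X * (∫⁻ Y, pinned w X (Fin p) Y ∂iid ν (Fin p)).toReal ∂iid ν (Fin N) := by
  have hm : Measurable fun q : (Fin N → E) × (Fin p → E) =>
      w (Fin N ⊕ Fin p) (Sum.elim q.1 q.2) :=
    (hw.measurable _).comp measurable_sumElim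
  rw [← integral_iid_comp_equiv _ (finSumFinEquiv (m := N) (n := p)).symm, integral_iid_sum]
  have e : ∀ q : (Fin N → E) × (Fin p → E),
      (w (Fin (N + p)) (Sum.elim q.1 q.2 ∘ (finSumFinEquiv (m := N) (n := p)).symm)).toReal *
        Φ ((Sum.elim q.1 q.2 ∘ (finSumFinEquiv (m := N) (n := p)).symm) ∘ Fin.castAdd p) =
      Φ q.1 * (w (Fin N ⊕ Fin p) (Sum.elim q.1 q.2)).toReal := fun q => by
    rw [hw.comp_equiv, mul_comm]
    congr 2
    funext i
    simp
  rw [integral_congr_ae (ae_of_all _ e), integral_prod]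
  · refine integral_congr_ae (ae_of_all _ fun X => ?_)
    have hmX : Measurable fun Y : Fin p → E => w (Fin N ⊕ Fin p) (Sum.elim X Y) :=
      hm.comp measurable_prodMk_left
    simp only
    rw [integral_const_mul, integral_toReal hmX.aemeasurable]
    · rfl
    · exact ae_of_all _ fun Y => (hw1 _ _).trans_lt ENNReal.one_lt_top
  · refine (hΦ.comp_fst _).mul_bdd (c := 1) hm.ennreal_toReal.aestronglyMeasurable
      (ae_of_all _ fun q => ?_)
    rw [Real.norm_of_nonneg ENNReal.toReal_nonneg]
    exact ENNReal.toReal_le_of_le_ofReal zero_le_one (by simpa using hw1 _ _)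

variable {d : ℕ} {ε : ℝ}

lemma isWeight_overlap (d : ℕ) (ε : ℝ) :
    IsWeight (hardCoreWeight (Overlap ε : Phase d → Phase d → Prop)) :=
  isWeight_hardCoreWeight (measurableSet_overlap ε)

lemma hsWeight_eq {n : ℕ} (Z : Fin n → Phase d) :
    hsWeight d ε Z = (∏ i, maxwellian d (Z i).2) *
      (hardCoreWeight (Overlap ε) (Fin n) Z).toReal := by
  by_cases h : Indep (Overlap ε) Z <;> simp [hsWeight, hardCore_iff_indep, hardCoreWeight, h]

lemma integral_hsWeight_mul {n : ℕ} (F : (Fin n → Phase d) → ℝ) :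
    ∫ Z, hsWeight d ε Z * F Z = ∫ Z, (hardCoreWeight (Overlap ε) (Fin n) Z).toReal * F Z
      ∂iid (phaseMeasure d) (Fin n) := by
  rw [integral_iid_phaseMeasure]
  simp only [hsWeight_eq, mul_assoc]

lemma integral_hsWeight (n : ℕ) : ∫ Z : Fin n → Phase d, hsWeight d ε Z =
    (∫⁻ Z, hardCoreWeight (Overlap ε) (Fin n) Z ∂iid (phaseMeasure d) (Fin n)).toReal := by
  have := integral_hsWeight_mul (d := d) (ε := ε) (n := n) fun _ => 1
  simp only [mul_one] at this
  rw [this, integral_toReal ((isWeight_overlap d ε).measurable _).aemeasurable]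
  exact ae_of_all _ fun Z => (hardCoreWeight_le_one _ _ Z).trans_lt ENNReal.one_lt_top

lemma lintegral_hsWeight_mul {n : ℕ} {F : (Fin n → Phase d) → ℝ} (hF : Measurable F) :
    ∫⁻ Z, ENNReal.ofReal (hsWeight d ε Z * F Z) =
      ∫⁻ Z, hardCoreWeight (Overlap ε) (Fin n) Z * ENNReal.ofReal (F Z)
        ∂iid (phaseMeasure d) (Fin n) := by
  refine Eq.trans (lintegral_congr fun Z => ?_) (lintegral_iid_phaseMeasure _ _
    (((isWeight_overlap d ε).measurable _).mul hF.ennreal_ofReal)).symm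
  rw [Pi.mul_apply]
  have h0 : 0 ≤ ∏ i, maxwellian d (Z i).2 :=
    Finset.prod_nonneg fun i _ => (maxwellian_pos d _).le
  rw [hsWeight_eq, mul_assoc, ENNReal.ofReal_mul h0,
    ENNReal.ofReal_prod_of_nonneg fun i _ => (maxwellian_pos d _).le,
    ENNReal.ofReal_mul ENNReal.toReal_nonneg, ENNReal.ofReal_toReal]
  exact ((hardCoreWeight_le_one _ _ Z).trans_lt ENNReal.one_lt_top).ne

lemma toReal_ofReal_pow_div_factorial {μ : ℝ} (hμ : 0 ≤ μ) (n : ℕ) :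
    (ENNReal.ofReal μ ^ n / (n.factorial : ℝ≥0∞)).toReal = μ ^ n / n.factorial := by
  rw [ENNReal.toReal_div, ENNReal.toReal_pow, ENNReal.toReal_ofReal hμ, ENNReal.toReal_natCast]

lemma ofReal_pow_div_factorial {μ : ℝ} (hμ : 0 ≤ μ) (n : ℕ) :
    ENNReal.ofReal (μ ^ n / n.factorial) = ENNReal.ofReal μ ^ n / (n.factorial : ℝ≥0∞) := by
  rw [ENNReal.ofReal_div_of_pos (by positivity), ENNReal.ofReal_pow hμ, ENNReal.ofReal_natCast]

lemma mu_pos (hε : 0 < ε) : 0 < mu d ε := by unfold mu; positivity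

lemma partitionFn_eq (hε : 0 < ε) : partitionFn d ε =
    (grandSum (ENNReal.ofReal (mu d ε)) (phaseMeasure d) (hardCoreWeight (Overlap ε))).toReal := by
  have hne := grandSum_hardCoreWeight_ne_top (Overlap ε : Phase d → Phase d → Prop)
    (ENNReal.ofReal_ne_top (r := mu d ε)) (phaseMeasure d)
  unfold grandSum at hne ⊢
  rw [ENNReal.tsum_toReal_eq fun n => ENNReal.ne_top_of_tsum_ne_top hne n, partitionFn]
  refine tsum_congr fun n => ?_
  rw [ENNReal.toReal_mul, toReal_ofReal_pow_div_factorial (mu_pos hε).le, integral_hsWeight]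

lemma EexpPhi_eq (hε : 0 < ε) {N : ℕ} {Φ : (Fin N → Phase d) → ℝ}
    (hΦ : Integrable Φ (iid (phaseMeasure d) (Fin N))) :
    EexpPhi d ε Φ =
      (grandSum (ENNReal.ofReal (mu d ε)) (phaseMeasure d)
        (hardCoreWeight (Overlap ε))).toReal⁻¹ *
      ∫ X, Φ X * (grandSum (ENNReal.ofReal (mu d ε)) (phaseMeasure d)
        (pinned (hardCoreWeight (Overlap ε)) X)).toReal ∂iid (phaseMeasure d) (Fin N) := by
  have hw := isWeight_overlap d ε
  set m := ENNReal.ofReal (mu d ε)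
  set ν := phaseMeasure d
  have hZ := grandSum_hardCoreWeight_ne_top (Overlap ε : Phase d → Phase d → Prop)
    (ENNReal.ofReal_ne_top (r := mu d ε)) ν
  have hne : ∀ X : Fin N → Phase d,
      grandSum m ν (pinned (hardCoreWeight (Overlap ε)) X) ≠ ∞ := fun X =>
    ne_top_of_le_ne_top hZ (grandSum_pinned_hardCoreWeight_le _ m ν X)
  let J : ℕ → (Fin N → Phase d) → ℝ≥0∞ := fun p X => m ^ p / (p.factorial : ℝ≥0∞) *
    ∫⁻ Y, pinned (hardCoreWeight (Overlap ε)) X (Fin p) Y ∂iid ν (Fin p)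
  have hJ : ∀ p, Measurable (J p) := fun p => by
    refine Measurable.const_mul (Measurable.lintegral_prod_right ?_) _
    exact (hw.measurable (Fin N ⊕ Fin p)).comp measurable_sumElim
  have hJne : ∀ X p, J p X ≠ ∞ := fun X p => ENNReal.ne_top_of_tsum_ne_top (hne X) p
  have hsum : ∀ X, Φ X * (grandSum m ν (pinned (hardCoreWeight (Overlap ε)) X)).toReal =
      ∑' p, Φ X * (J p X).toReal := fun X => by
    rw [tsum_mul_left, ← ENNReal.tsum_toReal_eq (hJne X)]
    rfl
  rw [EexpPhi, partitionFn_eq hε]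
  congr 1
  rw [integral_congr_ae (ae_of_all _ hsum), integral_tsum]
  · refine tsum_congr fun p => ?_
    rw [integral_hsWeight_mul fun Z : Fin (N + p) → Phase d => Φ (Z ∘ Fin.castAdd p),
      integral_weight_mul_comp_castAdd _ hw (hardCoreWeight_le_one _) hΦ, ← integral_const_mul]
    refine integral_congr_ae (ae_of_all _ fun X => ?_)
    simp only [J, m]
    rw [ENNReal.toReal_mul, toReal_ofReal_pow_div_factorial (mu_pos hε).le]
    ring
  · exact fun p => hΦ.aestronglyMeasurable.mul (hJ p).ennreal_toReal.aestronglyMeasurable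
  · have hen : ∀ p X, ‖Φ X * (J p X).toReal‖ₑ = ‖Φ X‖ₑ * J p X := fun p X => by
      rw [enorm_mul, Real.enorm_of_nonneg ENNReal.toReal_nonneg, ENNReal.ofReal_toReal (hJne X p)]
    simp only [hen]
    have hm : ∀ p, AEMeasurable (fun X => ‖Φ X‖ₑ * J p X) (iid ν (Fin N)) := fun p =>
      hΦ.aestronglyMeasurable.enorm.mul (hJ p).aemeasurable
    rw [← lintegral_tsum hm]
    refine ne_top_of_le_ne_top (ENNReal.mul_ne_top hΦ.2.ne hZ) ?_
    rw [← lintegral_mul_const' _ _ hZ]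
    refine lintegral_mono fun X => ?_
    rw [ENNReal.tsum_mul_left]
    exact mul_le_mul_right (grandSum_pinned_hardCoreWeight_le _ m ν X) _

lemma tsum_hsWeight_eq (hε : 0 < ε) {N : ℕ} {Φ : (Fin N → Phase d) → ℝ} (hΦ : Measurable Φ) :
    ∑' n : ℕ, ENNReal.ofReal (mu d ε ^ n / n.factorial) *
        ∫⁻ Z : Fin n → Phase d, ENNReal.ofReal (hsWeight d ε Z * (mu d ε * hatPhi d ε Φ n Z ^ 2)) =
      ENNReal.ofReal (mu d ε) * ∫⁻ ω,
        ENNReal.ofReal (((mu d ε ^ Fintype.card (Fin N))⁻¹ * tupleSum Φ ω - EexpPhi d ε Φ) ^ 2)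
        ∂gibbs (ENNReal.ofReal (mu d ε)) (phaseMeasure d) (hardCoreWeight (Overlap ε)) := by
  have hμ := mu_pos (d := d) hε
  have hf : Measurable fun ω : Σ n : ℕ, (Fin n → Phase d) => ENNReal.ofReal
      (((mu d ε ^ Fintype.card (Fin N))⁻¹ * tupleSum Φ ω - EexpPhi d ε Φ) ^ 2) :=
    ((((measurable_tupleSum hΦ).const_mul _).sub_const _).pow_const 2).ennreal_ofReal
  have hhat : ∀ n Z, hatPhi d ε Φ n Z =
      (mu d ε ^ Fintype.card (Fin N))⁻¹ * tupleSum Φ ⟨n, Z⟩ - EexpPhi d ε Φ := fun n Z => by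
    rw [hatPhi, tupleSum, Fintype.card_fin]
  rw [← lintegral_const_mul _ hf, lintegral_gibbs (isWeight_overlap d ε) (hf.const_mul _)]
  refine tsum_congr fun n => ?_
  rw [ofReal_pow_div_factorial hμ.le, lintegral_hsWeight_mul]
  · congr 1
    refine lintegral_congr fun Z => ?_
    rw [ENNReal.ofReal_mul hμ.le, hhat]
  · simp only [hhat]
    exact ((((measurable_sigma_iff.1 (measurable_tupleSum hΦ) n).const_mul _).sub_const _).pow_const
      2).const_mul _

end Ensemble

section QuasiOrthogonality

lemma mem_overlapTypes {ι : Type} [Fintype ι] {t : ι → Option ι} :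
    t ∈ overlapTypes ι ↔ Function.Injective (glueIdx t) ∧ ∃ i, t i ≠ none := by
  simp [overlapTypes]

lemma one_le_card_ne_none {ι : Type} [Fintype ι] {t : ι → Option ι} (ht : t ∈ overlapTypes ι) :
    1 ≤ Fintype.card {i // t i ≠ none} := by
  obtain ⟨i, hi⟩ := (mem_overlapTypes.1 ht).2
  exact Fintype.card_pos_iff.2 ⟨⟨i, hi⟩⟩

lemma lintegral_cross_le {d N : ℕ} {Φ : (Fin N → Phase d) → ℝ} (hΦ : Measurable Φ)
    (hσ : ∀ σ : Equiv.Perm (Fin N), ∀ Z, Φ (Z ∘ σ) = Φ Z) {B : ℕ → ℝ≥0∞}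
    (hB : ∀ (l : ℕ) (_ : 1 ≤ l) (_ : l ≤ N) (x : Torus d),
      ∫⁻ Z, ENNReal.ofReal
          (|Φ (Z ∘ Fin.castLE (by omega)) *
              Φ (fun i : Fin N => Z ⟨if (i : ℕ) < l then (i : ℕ) else (i : ℕ) + (N - l),
                by have := i.isLt; split <;> omega⟩)| * ∏ i, maxwellian d (Z i).2)
        ∂(lastFixed d (2 * N - l) x) ≤ B l)
    {t : Fin N → Option (Fin N)} (hinj : Function.Injective (glueIdx t))
    [Fintype {i // t i = none}] {l : ℕ} (hl : 1 ≤ l) (hcard : Nat.card {i // t i ≠ none} = l) :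
    ∫⁻ X, ‖Φ (X ∘ Sum.inl) * Φ (X ∘ glueIdx t)‖ₑ
      ∂iid (phaseMeasure d) (Fin N ⊕ {i // t i = none}) ≤ B l := by
  obtain ⟨hlN, e, he, he'⟩ :=
    exists_equiv_glueIdx hinj ((Nat.card_eq_fintype_card (α := {i // t i ≠ none})).symm.trans hcard)
  rw [← lintegral_iid_comp_equiv (phaseMeasure d) e]
  have h1 : ∀ Z : Fin (2 * N - l) → Phase d,
      Φ ((Z ∘ e) ∘ Sum.inl) = Φ (Z ∘ Fin.castLE (by omega)) := fun Z =>
    comp_eq_of_range_subset hσ (e.injective.comp Sum.inl_injective) he Z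
  have h2 : ∀ Z : Fin (2 * N - l) → Phase d, Φ ((Z ∘ e) ∘ glueIdx t) =
      Φ (fun i : Fin N => Z ⟨if (i : ℕ) < l then (i : ℕ) else (i : ℕ) + (N - l),
        by have := i.isLt; split <;> omega⟩) := fun Z =>
    comp_eq_of_range_subset hσ (e.injective.comp hinj) he' Z
  simp only [h1, h2]
  refine lintegral_iid_le_of_lastFixed_one (by omega) ?_ fun x => ?_
  · refine Measurable.enorm (Measurable.mul (hΦ.comp ?_) (hΦ.comp ?_)) <;> fun_prop
  · simpa only [ofReal_abs_mul_prod_maxwellian] using hB l hl hlN x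

lemma sum_overlapTypes_le {ι : Type} [Fintype ι] [Nonempty ι] {μ C : ℝ} (hμ : 0 < μ) (hC : 0 ≤ C)
    {ρ : ℕ → ℝ} (hρ : ∀ l ∈ Finset.Icc 1 (Fintype.card ι), 0 < ρ l) :
    ENNReal.ofReal μ * ∑ t ∈ overlapTypes ι,
        (ENNReal.ofReal μ ^ Fintype.card {i // t i ≠ none})⁻¹ *
          ENNReal.ofReal (C * (μ ^ (Fintype.card {i // t i ≠ none} - 1) /
            (Fintype.card ι : ℝ) ^ Fintype.card {i // t i ≠ none}) *
              ρ (Fintype.card {i // t i ≠ none})) ≤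
      ENNReal.ofReal (2 ^ Fintype.card ι * C * ∑ l ∈ Finset.Icc 1 (Fintype.card ι), ρ l) := by
  have hN0 : (0 : ℝ) < Fintype.card ι := by exact_mod_cast Fintype.card_pos
  set S := ∑ l ∈ Finset.Icc 1 (Fintype.card ι), ρ l
  have hS0 : 0 ≤ S := Finset.sum_nonneg fun l hl => (hρ l hl).le
  have hterm : ∀ t ∈ overlapTypes ι, ENNReal.ofReal μ *
      ((ENNReal.ofReal μ ^ Fintype.card {i // t i ≠ none})⁻¹ *
        ENNReal.ofReal (C * (μ ^ (Fintype.card {i // t i ≠ none} - 1) /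
          (Fintype.card ι : ℝ) ^ Fintype.card {i // t i ≠ none}) * ρ (Fintype.card {i // t i ≠ none}))) ≤
      ENNReal.ofReal (C * S * ((Fintype.card ι : ℝ)⁻¹) ^
        Fintype.card {i // t i ≠ none}) := fun t ht => by
    have hl := one_le_card_ne_none ht
    have hlN : Fintype.card {i // t i ≠ none} ≤ Fintype.card ι :=
      Fintype.card_subtype_le _
    generalize Fintype.card {i // t i ≠ none} = l at hl hlN
    rw [← ENNReal.ofReal_pow hμ.le, ← ENNReal.ofReal_inv_of_pos (by positivity),
      ← ENNReal.ofReal_mul (by positivity), ← ENNReal.ofReal_mul hμ.le]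
    refine ENNReal.ofReal_le_ofReal ?_
    have hρl : ρ l ≤ S := Finset.single_le_sum (f := ρ) (fun l hl => (hρ l hl).le)
      (Finset.mem_Icc.2 ⟨hl, hlN⟩)
    obtain ⟨k, rfl⟩ : ∃ k, l = k + 1 := ⟨l - 1, by omega⟩
    calc μ * ((μ ^ (k + 1))⁻¹ * (C * (μ ^ (k + 1 - 1) / (Fintype.card ι : ℝ) ^ (k + 1)) * ρ (k + 1)))
        = C * ρ (k + 1) * ((Fintype.card ι : ℝ)⁻¹) ^ (k + 1) := by
          rw [Nat.add_sub_cancel, inv_pow]; field_simp; ring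
      _ ≤ C * S * ((Fintype.card ι : ℝ)⁻¹) ^ (k + 1) := by gcongr
  rw [Finset.mul_sum]
  calc _ ≤ ∑ t ∈ overlapTypes ι, ENNReal.ofReal (C * S * ((Fintype.card ι : ℝ)⁻¹) ^
        Fintype.card {i // t i ≠ none}) := Finset.sum_le_sum hterm
    _ ≤ ∑ t : ι → Option ι, ENNReal.ofReal (C * S *
        ((Fintype.card ι : ℝ)⁻¹) ^ Fintype.card {i // t i ≠ none}) :=
      Finset.sum_le_sum_of_subset (Finset.subset_univ _)
    _ = ENNReal.ofReal (2 ^ Fintype.card ι * C * S) := by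
      rw [← ENNReal.ofReal_sum_of_nonneg fun t _ => by positivity, ← Finset.mul_sum,
        sum_option_inv_card_pow]
      congr 1
      ring

lemma mu_mul_pow (d : ℕ) {ε : ℝ} (hε : 0 < ε) : mu d ε * (2 * ε) ^ d = 2 ^ d * ε := by
  have : ε ^ (-((d : ℤ) - 1)) * ε ^ d = ε := by
    rw [← zpow_natCast, ← zpow_add₀ hε.ne']
    simp
  rw [mu, mul_pow, mul_left_comm, this]

lemma two_mul_sq_mul_pow_le (d : ℕ) {N : ℕ} (hN : 1 ≤ N) (C : ℝ) :
    2 * (N : ℝ) ^ 2 * (C ^ N) ^ 2 * 2 ^ d ≤ (2 ^ (d + 3) * C ^ 2) ^ N := by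
  have h1 : (N : ℝ) ≤ 2 ^ N := by exact_mod_cast N.lt_two_pow_self.le
  have h2 : (2 : ℝ) ^ (d + 1) ≤ (2 ^ (d + 1)) ^ N :=
    le_self_pow₀ (one_le_pow₀ one_le_two) (by omega)
  calc 2 * (N : ℝ) ^ 2 * (C ^ N) ^ 2 * 2 ^ d = 2 ^ (d + 1) * (N : ℝ) ^ 2 * (C ^ 2) ^ N := by ring
    _ ≤ (2 ^ (d + 1)) ^ N * (2 ^ N) ^ 2 * (C ^ 2) ^ N := by gcongr
    _ = (2 ^ (d + 3) * C ^ 2) ^ N := by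
      rw [← pow_mul 2 N, mul_comm N 2, pow_mul 2 2, ← mul_pow, ← mul_pow]
      congr 1
      ring

theorem quasi_orthogonality {d : ℕ} {C₀ ε : ℝ} (hC₀ : 0 < C₀) (hε : 0 < ε)
    (hε₀ : ε < (2 ^ (d + 2))⁻¹) {N : ℕ} (hN : 1 ≤ N) {ρ₀ : ℝ} (hρ₀ : 0 < ρ₀) {ρ : ℕ → ℝ}
    (hρ : ∀ l ∈ Finset.Icc 1 N, 0 < ρ l) {Φ : (Fin N → Phase d) → ℝ} (hΦ : Measurable Φ)
    (hσ : ∀ σ : Equiv.Perm (Fin N), ∀ Z, Φ (Z ∘ σ) = Φ Z)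
    (hi : ∀ x : Torus d, ∫⁻ Z, ENNReal.ofReal (|Φ Z| * ∏ i, maxwellian d (Z i).2)
      ∂(lastFixed d N x) ≤ ENNReal.ofReal (C₀ ^ N * ρ₀))
    (hii : ∀ (l : ℕ) (_ : 1 ≤ l) (_ : l ≤ N) (x : Torus d),
      ∫⁻ Z, ENNReal.ofReal
          (|Φ (Z ∘ Fin.castLE (by omega)) *
              Φ (fun i : Fin N => Z ⟨if (i : ℕ) < l then (i : ℕ) else (i : ℕ) + (N - l),
                by have := i.isLt; split <;> omega⟩)| * ∏ i, maxwellian d (Z i).2)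
        ∂(lastFixed d (2 * N - l) x) ≤
          ENNReal.ofReal (C₀ ^ N * (mu d ε ^ (l - 1) / (N : ℝ) ^ l) * ρ l)) :
    (∑' n : ℕ, ENNReal.ofReal (mu d ε ^ n / n.factorial) *
        ∫⁻ Z : Fin n → Phase d,
          ENNReal.ofReal (hsWeight d ε Z * (mu d ε * hatPhi d ε Φ n Z ^ 2))) /
        ENNReal.ofReal (partitionFn d ε) ≤
      ENNReal.ofReal ((2 * C₀ + 2 ^ (d + 3) * C₀ ^ 2) ^ N *
        ((∑ l ∈ Finset.Icc 1 N, ρ l) + ρ₀ ^ 2 * ε)) := by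
  have hμ := mu_pos (d := d) hε
  have hS0 : 0 ≤ ∑ l ∈ Finset.Icc 1 N, ρ l := Finset.sum_nonneg fun l hl => (hρ l hl).le
  simp only [ofReal_abs_mul_prod_maxwellian] at hi
  have ha := lintegral_iid_le_of_lastFixed_one hN hΦ.enorm hi
  have hint : Integrable Φ (iid (phaseMeasure d) (Fin N)) :=
    ⟨hΦ.aestronglyMeasurable, ha.trans_lt ENNReal.ofReal_lt_top⟩
  have hμκ : 2 * ENNReal.ofReal (mu d ε) * ENNReal.ofReal ((2 * ε) ^ d) ≤ 2⁻¹ := by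
    rw [mul_assoc, ← ENNReal.ofReal_mul hμ.le, mu_mul_pow d hε, ← ENNReal.ofReal_ofNat 2,
      ← ENNReal.ofReal_mul zero_le_two, ← ENNReal.ofReal_inv_of_pos two_pos]
    refine ENNReal.ofReal_le_ofReal ?_
    calc 2 * (2 ^ d * ε) ≤ 2 * (2 ^ d * (2 ^ (d + 2))⁻¹) := by gcongr
      _ = 2⁻¹ := by rw [pow_add]; field_simp
  have hsymm : ∀ z w : Phase d, Overlap ε z w → Overlap ε w z := fun _ _ h => h.symm
  have hover := phaseMeasure_overlap_le (d := d) hε.le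
  have hpinned : ∀ (x : Phase d) (j : Fin N), ∫⁻ X, ‖Φ X‖ₑ * (if Overlap ε x (X j) then 1 else 0)
      ∂iid (phaseMeasure d) (Fin N) ≤
      ENNReal.ofReal ((2 * ε) ^ d) * ENNReal.ofReal (C₀ ^ N * ρ₀) := fun x j =>
    lintegral_iid_overlap_le hε.le hΦ.enorm (fun σ Z => by rw [hσ]) hi x j
  set B : ℕ → ℝ≥0∞ := fun l =>
    ENNReal.ofReal (C₀ ^ N * (mu d ε ^ (l - 1) / (N : ℝ) ^ l) * ρ l)
  have hvar := variance_tupleSum_le (R := Overlap ε) hsymm (measurableSet_overlap (d := d) ε) hμ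
    (phaseMeasure d) (κ := ENNReal.ofReal ((2 * ε) ^ d)) (a := ENNReal.ofReal (C₀ ^ N * ρ₀))
    (b := ENNReal.ofReal ((2 * ε) ^ d) * ENNReal.ofReal (C₀ ^ N * ρ₀)) hover hμκ hΦ
    ENNReal.ofReal_ne_top ha hpinned (B := B) (fun _ => ENNReal.ofReal_ne_top)
    (fun t ht => lintegral_cross_le hΦ hσ hii (mem_overlapTypes.1 ht).1
      (one_le_card_ne_none ht) Nat.card_eq_fintype_card) (EexpPhi_eq hε hint)
  rw [tsum_hsWeight_eq hε hΦ, partitionFn_eq hε, ENNReal.ofReal_toReal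
    (grandSum_hardCoreWeight_ne_top _ ENNReal.ofReal_ne_top _)]
  refine ENNReal.div_le_of_le_mul' ((mul_le_mul_right hvar _).trans ?_)
  rw [mul_left_comm]
  refine mul_le_mul_right ?_ _
  rw [mul_add]
  have hzero : ENNReal.ofReal (mu d ε) * (2 * (Fintype.card (Fin N) : ℝ≥0∞) ^ 2 *
      ENNReal.ofReal (C₀ ^ N * ρ₀) *
        (ENNReal.ofReal ((2 * ε) ^ d) * ENNReal.ofReal (C₀ ^ N * ρ₀))) =
      ENNReal.ofReal (2 * (N : ℝ) ^ 2 * (C₀ ^ N) ^ 2 * 2 ^ d * (ρ₀ ^ 2 * ε)) := by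
    rw [Fintype.card_fin, ← ENNReal.ofReal_natCast, ← ENNReal.ofReal_ofNat 2,
      ← ENNReal.ofReal_pow (by positivity), ← ENNReal.ofReal_mul (by positivity),
      ← ENNReal.ofReal_mul (by positivity), ← ENNReal.ofReal_mul (by positivity),
      ← ENNReal.ofReal_mul (by positivity), ← ENNReal.ofReal_mul (by positivity)]
    congr 1
    linear_combination 2 * (N : ℝ) ^ 2 * (C₀ ^ N * ρ₀) ^ 2 * mu_mul_pow d hε
  have : Nonempty (Fin N) := ⟨⟨0, hN⟩⟩
  have hone := sum_overlapTypes_le (ι := Fin N) hμ (pow_nonneg hC₀.le N) (ρ := ρ)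
    (by rwa [Fintype.card_fin])
  simp only [Fintype.card_fin N] at hone
  refine (add_le_add hone hzero.le).trans ?_
  rw [← ENNReal.ofReal_add (by positivity) (by positivity)]
  refine ENNReal.ofReal_le_ofReal ?_
  rw [mul_add]
  refine add_le_add (mul_le_mul_of_nonneg_right ?_ hS0)
    (mul_le_mul_of_nonneg_right ((two_mul_sq_mul_pow_le d hN C₀).trans ?_) (by positivity))
  · rw [← mul_pow]
    exact pow_le_pow_left₀ (by positivity) (le_add_of_nonneg_right (by positivity)) N
  · exact pow_le_pow_left₀ (by positivity) (le_add_of_nonneg_left (by positivity)) N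

end QuasiOrthogonality

end HardCoreGas

/-- Second conclusion (3.5) of Proposition 3.1 (quasi-orthogonality estimate): under
the `L¹` bound (i) and the cross bounds (ii), the grand canonical expectation of
`μ_ε Φ̂_N²` is at most `C̃^N (∑_{ℓ=1}^N ρ_ℓ + ρ₀² ε)`. -/
theorem stmt_8 (d : ℕ) (hd : 2 ≤ d) (C₀ : ℝ) (hC₀ : 0 < C₀) :
    ∃ ε₀ ∈ Set.Ioo (0 : ℝ) 1, ∃ C' : ℝ, 0 < C' ∧
      ∀ ε : ℝ, 0 < ε → ε < ε₀ →
      ∀ N : ℕ, 1 ≤ N →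
      ∀ ρ₀ : ℝ, 0 < ρ₀ →
      ∀ ρ : ℕ → ℝ, (∀ ℓ ∈ Finset.Icc 1 N, 0 < ρ ℓ) →
      ∀ Φ : (Fin N → Phase d) → ℝ, Measurable Φ →
        (∀ σ : Equiv.Perm (Fin N), ∀ Z, Φ (Z ∘ σ) = Φ Z) →
        -- hypothesis (i)
        (∀ x : Torus d,
          ∫⁻ Z, ENNReal.ofReal (|Φ Z| * ∏ i, maxwellian d (Z i).2) ∂(lastFixed d N x)
            ≤ ENNReal.ofReal (C₀ ^ N * ρ₀)) →
        -- hypothesis (ii)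
        (∀ (ℓ : ℕ) (hℓ1 : 1 ≤ ℓ) (hℓN : ℓ ≤ N) (x : Torus d),
          ∫⁻ Z,
              ENNReal.ofReal
                (|Φ (Z ∘ Fin.castLE (by omega)) *
                    Φ (fun i : Fin N =>
                      Z ⟨if (i : ℕ) < ℓ then (i : ℕ) else (i : ℕ) + (N - ℓ),
                        by have := i.isLt; split <;> omega⟩)| *
                  ∏ i, maxwellian d (Z i).2)
            ∂(lastFixed d (2 * N - ℓ) x)
            ≤ ENNReal.ofReal (C₀ ^ N * (mu d ε ^ (ℓ - 1) / (N : ℝ) ^ ℓ) * ρ ℓ)) →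
        (∑' n : ℕ,
            ENNReal.ofReal (mu d ε ^ n / n.factorial) *
              ∫⁻ Z : Fin n → Phase d,
                ENNReal.ofReal (hsWeight d ε Z * (mu d ε * hatPhi d ε Φ n Z ^ 2))) /
          ENNReal.ofReal (partitionFn d ε)
          ≤ ENNReal.ofReal (C' ^ N * ((∑ ℓ ∈ Finset.Icc 1 N, ρ ℓ) + ρ₀ ^ 2 * ε)) := by
  refine ⟨(2 ^ (d + 2))⁻¹, ⟨by positivity, inv_lt_one_of_one_lt₀ (one_lt_pow₀ one_lt_two (by omega))⟩,
    2 * C₀ + 2 ^ (d + 3) * C₀ ^ 2, by positivity, ?_⟩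
  intro ε hε hε₀ N hN ρ₀ hρ₀ ρ hρ Φ hΦ hσ hi hii
  exact HardCoreGas.quasi_orthogonality hC₀ hε hε₀ hN hρ₀ hρ hΦ hσ hi hii
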